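/- arXiv:2407.06338 — 3 statements merged into one kernel-verified Lean document; each statement's English description precedes it below -/
import Mathlib

section
/- For every n ≥ 1 and every permutation π ∈ S_n, π is irreducible if and only if θ(π) is irreducible, where θ is the fundamental bijection. -/
/-- The one-line word of the image of `π` under the fundamental bijection:
write `π` in standard cycle form (every cycle written with its largest element
first, cycles listed in increasing order of their largest elements) and erase
the parentheses.  The cycle maxima are exactly the `x` with `π^[k] x ≤ x` for
all `k`, and the cycle of `x` is `x, π x, π² x, …` up to the period of `x`. -/
noncomputable def fundWord {n : ℕ} (π : Equiv.Perm (Fin n)) : List (Fin n) :=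
  ((List.finRange n).filter fun x => (List.range n).all fun k => decide ((⇑π)^[k] x ≤ x)).flatMap
    fun x => (List.range (Function.minimalPeriod (⇑π) x)).map fun k => (⇑π)^[k] x

/-- The permutation whose one-line notation is the word `w`
(junk value if `w` is not the one-line notation of a permutation). -/
noncomputable def permOfWord {n : ℕ} (w : List (Fin n)) : Equiv.Perm (Fin n) :=
  Function.invFun (fun σ : Equiv.Perm (Fin n) => (List.finRange n).map ⇑σ) w

/-- The fundamental bijection `θ`. -/
noncomputable def theta {n : ℕ} (π : Equiv.Perm (Fin n)) : Equiv.Perm (Fin n) :=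
  permOfWord (fundWord π)

/-- `π` contains the pattern `σ`. -/
def Contains {k n : ℕ} (σ : Equiv.Perm (Fin k)) (π : Equiv.Perm (Fin n)) : Prop :=
  ∃ f : Fin k → Fin n, StrictMono f ∧ ∀ a b : Fin k, π (f a) < π (f b) ↔ σ a < σ b

/-- `π` avoids the pattern `σ`. -/
def Avoids {k n : ℕ} (π : Equiv.Perm (Fin n)) (σ : Equiv.Perm (Fin k)) : Prop :=
  ¬ Contains σ π

noncomputable def p123 : Equiv.Perm (Fin 3) := Equiv.ofBijective ![0, 1, 2] (by decide)
noncomputable def p132 : Equiv.Perm (Fin 3) := Equiv.ofBijective ![0, 2, 1] (by decide)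
noncomputable def p213 : Equiv.Perm (Fin 3) := Equiv.ofBijective ![1, 0, 2] (by decide)
noncomputable def p231 : Equiv.Perm (Fin 3) := Equiv.ofBijective ![1, 2, 0] (by decide)
noncomputable def p312 : Equiv.Perm (Fin 3) := Equiv.ofBijective ![2, 0, 1] (by decide)
noncomputable def p321 : Equiv.Perm (Fin 3) := Equiv.ofBijective ![2, 1, 0] (by decide)

/-- The direct sum `π ⊕ τ` of two permutations. -/
def directSum {n m : ℕ} (π : Equiv.Perm (Fin n)) (τ : Equiv.Perm (Fin m)) :
    Equiv.Perm (Fin (n + m)) :=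
  finSumFinEquiv.permCongr (Equiv.sumCongr π τ)

/-- A permutation is irreducible if it is not a direct sum of two nonempty permutations. -/
def IrreduciblePerm {n : ℕ} (π : Equiv.Perm (Fin n)) : Prop :=
  ¬ ∃ (a b : ℕ) (_ : 0 < a) (_ : 0 < b) (h : a + b = n)
      (σ : Equiv.Perm (Fin a)) (τ : Equiv.Perm (Fin b)),
      π = (finCongr h).permCongr (directSum σ τ)

/-- A permutation is cyclic if its cycle decomposition is a single cycle of full length,
i.e. it acts transitively. -/
def IsCyclicPerm {n : ℕ} (π : Equiv.Perm (Fin n)) : Prop :=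
  ∀ x y : Fin n, ∃ k : ℕ, (⇑π)^[k] x = y

open Equiv.Perm in
/-- A permutation preserving an initial segment moves no point out of it along its cycles. -/
lemma SameCycle.lt_of_forall_lt {n : ℕ} {π : Equiv.Perm (Fin n)} {a x y : Fin n}
    (ha : ∀ z < a, π z < a) (h : π.SameCycle x y) (hx : x < a) : y < a := by
  obtain ⟨k, rfl⟩ := h.exists_nat_pow_eq
  induction k with
  | zero => simpa using hx
  | succ k ih => exact pow_succ' π k ▸ ha _ (ih (sameCycle_pow_right.2 (SameCycle.refl _ _)))

/-- A permutation is reducible iff it preserves a proper nonempty initial segment. -/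
lemma not_irreduciblePerm_iff {n : ℕ} (ρ : Equiv.Perm (Fin n)) :
    ¬ IrreduciblePerm ρ ↔ ∃ a : Fin n, 0 < a.val ∧ ∀ x < a, ρ x < a := by
  rw [IrreduciblePerm, not_not]
  constructor
  · rintro ⟨a, b, ha, hb, rfl, σ, τ, rfl⟩
    refine ⟨⟨a, by omega⟩, ha, fun x hx => ?_⟩
    obtain ⟨x, rfl⟩ : ∃ y : Fin a, x = Fin.castAdd b y := ⟨⟨x, hx⟩, rfl⟩
    simp [directSum, Fin.lt_def]
  · rintro ⟨⟨a, han⟩, ha, h⟩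
    obtain ⟨b, rfl⟩ := Nat.exists_eq_add_of_le han.le
    have key : finSumFinEquiv.symm.permCongr ρ ∈
        (Equiv.Perm.sumCongrHom (Fin a) (Fin b)).range := by
      apply Equiv.Perm.mem_sumCongrHom_range_of_perm_mapsTo_inl
      rintro _ ⟨x, rfl⟩
      have hx := h (Fin.castAdd b x) (by simp [Fin.lt_def])
      refine ⟨⟨ρ (Fin.castAdd b x), hx⟩, ?_⟩
      apply finSumFinEquiv.injective
      ext
      simp
    obtain ⟨⟨σ, τ⟩, hστ⟩ := key
    refine ⟨a, b, ha, by omega, rfl, σ, τ, ?_⟩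
    have hστ' : Equiv.sumCongr σ τ = finSumFinEquiv.symm.permCongr ρ := hστ
    ext x
    simp [directSum, hστ']

/-- `m` is the largest element of its cycle. -/
def IsCycleMax {n : ℕ} (π : Equiv.Perm (Fin n)) (m : Fin n) : Prop :=
  ∀ y, π.SameCycle m y → y ≤ m

lemma IsCycleMax.eq_of_sameCycle {n : ℕ} {π : Equiv.Perm (Fin n)} {m m' : Fin n}
    (hm : IsCycleMax π m) (hm' : IsCycleMax π m') (h : π.SameCycle m m') : m = m' :=
  le_antisymm (hm' _ h.symm) (hm _ h)

lemma exists_isCycleMax_sameCycle {n : ℕ} (π : Equiv.Perm (Fin n)) (x : Fin n) :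
    ∃ m, IsCycleMax π m ∧ π.SameCycle m x := by
  obtain ⟨m, hm, hmax⟩ := Set.exists_max_image {y | π.SameCycle x y} id (Set.toFinite _)
    ⟨x, Equiv.Perm.SameCycle.refl _ _⟩
  exact ⟨m, fun y hy => hmax y (hm.trans hy), hm.symm⟩

lemma minimalPeriod_pos_perm {n : ℕ} (π : Equiv.Perm (Fin n)) (x : Fin n) :
    0 < Function.minimalPeriod π x :=
  Function.minimalPeriod_pos_of_mem_periodicPts (π.injective.mem_periodicPts x)

lemma sameCycle_iff_exists_iterate_lt {n : ℕ} {π : Equiv.Perm (Fin n)} {x y : Fin n} :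
    π.SameCycle x y ↔ ∃ k < Function.minimalPeriod π x, (⇑π)^[k] x = y := by
  constructor
  · intro h
    obtain ⟨k, rfl⟩ := h.exists_nat_pow_eq
    refine ⟨k % Function.minimalPeriod π x, Nat.mod_lt _ (minimalPeriod_pos_perm π x), ?_⟩
    rw [Function.iterate_mod_minimalPeriod_eq, Equiv.Perm.iterate_eq_pow]
  · rintro ⟨k, -, rfl⟩
    rw [Equiv.Perm.iterate_eq_pow]
    exact Equiv.Perm.sameCycle_pow_right.2 (Equiv.Perm.SameCycle.refl _ _)

lemma all_iterate_le_iff_isCycleMax {n : ℕ} {π : Equiv.Perm (Fin n)} {x : Fin n} :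
    ((List.range n).all fun k => decide ((⇑π)^[k] x ≤ x)) = true ↔ IsCycleMax π x := by
  simp only [List.all_eq_true, List.mem_range, decide_eq_true_eq]
  constructor
  · intro h y hy
    obtain ⟨k, hk, rfl⟩ := sameCycle_iff_exists_iterate_lt.1 hy
    exact h k (hk.trans_le (by simpa using Function.minimalPeriod_le_card (f := π) (x := x)))
  · intro h k _
    rw [Equiv.Perm.iterate_eq_pow]
    exact h _ (Equiv.Perm.sameCycle_pow_right.2 (Equiv.Perm.SameCycle.refl _ _))

lemma mem_map_iterate_iff {n : ℕ} {π : Equiv.Perm (Fin n)} {x y : Fin n} :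
    y ∈ (List.range (Function.minimalPeriod π x)).map (fun k => (⇑π)^[k] x) ↔
      π.SameCycle x y := by
  simp [sameCycle_iff_exists_iterate_lt, eq_comm]

lemma mem_fundWord {n : ℕ} (π : Equiv.Perm (Fin n)) (x : Fin n) : x ∈ fundWord π := by
  obtain ⟨m, hm, hmx⟩ := exists_isCycleMax_sameCycle π x
  rw [fundWord, List.mem_flatMap]
  refine ⟨m, ?_, mem_map_iterate_iff.2 hmx⟩
  rw [List.mem_filter]
  exact ⟨List.mem_finRange m, all_iterate_le_iff_isCycleMax.2 hm⟩

/-- To compare letters of `fundWord π` by position, it suffices to compare letters inside one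
cycle by their distance to the maximum, and letters of two cycles with increasing maxima. -/
lemma pairwise_fundWord {n : ℕ} {π : Equiv.Perm (Fin n)} {R : Fin n → Fin n → Prop}
    (hin : ∀ m, IsCycleMax π m → ∀ i j, i < j → j < Function.minimalPeriod π m →
      R ((⇑π)^[i] m) ((⇑π)^[j] m))
    (hout : ∀ m m', IsCycleMax π m → IsCycleMax π m' → m < m' →
      ∀ u v, π.SameCycle m u → π.SameCycle m' v → R u v) :
    (fundWord π).Pairwise R := by
  rw [fundWord, List.pairwise_flatMap]
  constructor
  · intro m hm
    rw [List.mem_filter, all_iterate_le_iff_isCycleMax] at hm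
    rw [List.pairwise_map]
    refine List.pairwise_lt_range.imp_of_mem fun {i j} _ hj hij => ?_
    exact hin m hm.2 i j hij (List.mem_range.1 hj)
  · refine ((List.pairwise_lt_finRange n).filter _).imp_of_mem fun {m m'} hm hm' hlt u hu v hv => ?_
    rw [List.mem_filter, all_iterate_le_iff_isCycleMax] at hm hm'
    exact hout m m' hm.2 hm'.2 hlt u v (mem_map_iterate_iff.1 hu) (mem_map_iterate_iff.1 hv)

lemma nodup_fundWord {n : ℕ} (π : Equiv.Perm (Fin n)) : (fundWord π).Nodup := by
  refine pairwise_fundWord (fun m _ i j hij hj h => ?_) fun m m' hm hm' hlt u v hu hv h => ?_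
  · exact hij.ne (Function.iterate_injOn_Iio_minimalPeriod (hij.trans hj) hj h)
  · exact hlt.ne (hm.eq_of_sameCycle hm' (hu.trans (h ▸ hv.symm)))

/-- The word of `π` is the one-line notation of `theta π`. -/
lemma ofFn_theta {n : ℕ} (π : Equiv.Perm (Fin n)) : List.ofFn (theta π) = fundWord π := by
  have hlen : (fundWord π).length = n := by
    have h := List.toFinset_card_of_nodup (nodup_fundWord π)
    have h' : (fundWord π).toFinset = Finset.univ := by
      ext x
      simp [mem_fundWord]
    rw [← h, h', Finset.card_univ, Fintype.card_fin]
  have hinj : Function.Injective fun i : Fin n => (fundWord π)[i.val]'(by omega) := by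
    intro i j h
    exact Fin.ext ((nodup_fundWord π).getElem_inj_iff.1 h)
  have hex : ∃ σ : Equiv.Perm (Fin n), (List.finRange n).map ⇑σ = fundWord π := by
    refine ⟨Equiv.ofBijective _ (Finite.injective_iff_bijective.1 hinj), ?_⟩
    apply List.ext_getElem
    · simp [hlen]
    · intro i h₁ h₂
      simp
  rw [List.ofFn_eq_map]
  exact Function.invFun_eq hex

lemma theta_rel_of_lt {n : ℕ} {π : Equiv.Perm (Fin n)} {R : Fin n → Fin n → Prop}
    (h : (fundWord π).Pairwise R) {i j : Fin n} (hij : i < j) : R (theta π i) (theta π j) := by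
  rw [← ofFn_theta, List.pairwise_ofFn] at h
  exact h hij

/-- If `π` preserves an initial segment, its elements come first in the word of `π`. -/
lemma pairwise_fundWord_of_forall_lt {n : ℕ} {π : Equiv.Perm (Fin n)} {a : Fin n}
    (ha : ∀ x < a, π x < a) : (fundWord π).Pairwise fun u v => v < a → u < a := by
  refine pairwise_fundWord (fun m _ i j _ hj h => ?_) fun m m' _ _ hlt u v hu hv h => ?_
  · have hcyc (k : ℕ) : π.SameCycle m ((⇑π)^[k] m) := by
      rw [Equiv.Perm.iterate_eq_pow]
      exact Equiv.Perm.sameCycle_pow_right.2 (Equiv.Perm.SameCycle.refl _ _)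
    exact SameCycle.lt_of_forall_lt ha ((hcyc j).symm.trans (hcyc i)) h
  · exact SameCycle.lt_of_forall_lt ha hu (hlt.trans (SameCycle.lt_of_forall_lt ha hv.symm h))

/-- No element of a cycle precedes the maximum of that cycle in the word of `π`. -/
lemma pairwise_fundWord_not_sameCycle {n : ℕ} (π : Equiv.Perm (Fin n)) :
    (fundWord π).Pairwise fun u v => IsCycleMax π v → ¬ π.SameCycle v u := by
  refine pairwise_fundWord (fun m hm i j hij hj h _ => ?_)
    fun m m' hm hm' hlt u v hu hv hvm h => ?_
  · have hcyc : π.SameCycle m ((⇑π)^[j] m) := sameCycle_iff_exists_iterate_lt.2 ⟨j, hj, rfl⟩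
    have h0 : (⇑π)^[0] m = (⇑π)^[j] m := hm.eq_of_sameCycle h hcyc
    have := Function.iterate_injOn_Iio_minimalPeriod (minimalPeriod_pos_perm π m) hj h0
    omega
  · exact hlt.ne (hm.eq_of_sameCycle hm' (hu.trans (h.symm.trans hv.symm)))

/-- `π` is irreducible iff `θ(π)` is irreducible. -/
theorem irreduciblePerm_iff_irreduciblePerm_theta (n : ℕ) (hn : 1 ≤ n)
    (π : Equiv.Perm (Fin n)) :
    IrreduciblePerm π ↔ IrreduciblePerm (theta π) := by
  rw [← not_iff_not, not_irreduciblePerm_iff, not_irreduciblePerm_iff]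
  refine exists_congr fun a => and_congr_right fun _ => ⟨fun ha j hj => ?_, fun ha x hx => ?_⟩
  · by_contra hja
    have hsub : ∀ x ∈ Finset.Iio a, (theta π).symm x ∈ Finset.Iio j := by
      intro x hx
      rw [Finset.mem_Iio] at hx ⊢
      by_contra! hlt
      rcases hlt.eq_or_lt with rfl | hlt
      · exact hja (by simpa using hx)
      · exact hja (theta_rel_of_lt (pairwise_fundWord_of_forall_lt ha) hlt (by simpa using hx))
    have := Finset.card_le_card_of_injOn _ hsub (theta π).symm.injective.injOn
    rw [Fin.card_Iio, Fin.card_Iio] at this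
    exact absurd hj (not_lt.2 this)
  · obtain ⟨m, hm, hmx⟩ := exists_isCycleMax_sameCycle π x
    have hpos : (theta π).symm m ≤ (theta π).symm x := by
      by_contra! hlt
      have := theta_rel_of_lt (pairwise_fundWord_not_sameCycle π) hlt
      simp only [Equiv.apply_symm_apply] at this
      exact this hm hmx
    have hinv (y z : Fin n) (h : theta π y = z) : (theta π).SameCycle y z :=
      h ▸ Equiv.Perm.sameCycle_apply_right.2 (Equiv.Perm.SameCycle.refl _ _)
    have hx' : (theta π).symm x < a :=
      SameCycle.lt_of_forall_lt ha (hinv _ x (by simp)).symm hx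
    have hma : m < a := SameCycle.lt_of_forall_lt ha (hinv _ m (by simp)) (hpos.trans_lt hx')
    exact (hm _ (Equiv.Perm.sameCycle_apply_right.2 hmx)).trans_lt hma
end

section
/- For all n ≥ 1, the number of permutations π ∈ S_n such that both π and θ(π) avoid the pattern 132 is given by t_n(132) = Σ_{k=0}^{n+1} F_{n+1−k} · F_k. -/
/-- The values of `f` on the `n` positions `a, a + 1, …` avoid 132. -/
def FunAvoids (f : ℕ → ℕ) (a n : ℕ) : Prop :=
  ∀ i j k, a ≤ i → i < j → j < k → k < a + n → ¬ (f i < f k ∧ f k < f j)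

/-- The word `l` avoids 132. -/
def ListAvoids (l : List ℕ) : Prop :=
  l.Triplewise fun x y z => ¬ (x < z ∧ z < y)

/-- The words `R` for which the cycle `(a + n, R)` on `a, …, a + n` and its word avoid 132. -/
def cycleTails (a n : ℕ) : Set (List ℕ) :=
  {R | R.Perm (List.range' a n) ∧ ListAvoids R ∧
    FunAvoids (List.formPerm ((a + n) :: R)) a (n + 1)}

lemma formPerm_apply_append {s t : List ℕ} {x y : ℕ} (h : (s ++ x :: y :: t).Nodup) :
    List.formPerm (s ++ x :: y :: t) x = y := by
  have := List.formPerm_apply_lt_getElem _ h s.length (by simp)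
  simpa using this

lemma mem_of_perm_range' {R : List ℕ} {a n : ℕ} (h : R.Perm (List.range' a n)) (x : ℕ) :
    x ∈ R ↔ a ≤ x ∧ x < a + n := by
  rw [h.mem_iff, List.mem_range'_1]

lemma perm_range'_of {R : List ℕ} {a n : ℕ} (hR : R.Nodup) (h : ∀ x, x ∈ R ↔ a ≤ x ∧ x < a + n) :
    R.Perm (List.range' a n) := by
  rw [List.perm_ext_iff_of_nodup hR (List.nodup_range')]
  simp [h]

lemma nodup_of_perm_range' {R : List ℕ} {a n : ℕ} (h : R.Perm (List.range' a n)) : R.Nodup :=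
  h.nodup_iff.2 (List.nodup_range')

lemma nodup_cons_of_perm_range' {R : List ℕ} {a n : ℕ} (h : R.Perm (List.range' a n)) :
    ((a + n) :: R).Nodup := by
  rw [List.nodup_cons, mem_of_perm_range' h]
  exact ⟨by omega, nodup_of_perm_range' h⟩

lemma finite_cycleTails (a n : ℕ) : (cycleTails a n).Finite := by
  apply (List.finite_toSet (List.range' a n).permutations).subset
  intro R hR
  simpa using hR.1

lemma listAvoids_range' (a n : ℕ) : ListAvoids (List.range' a n) := by
  unfold ListAvoids
  rw [List.triplewise_iff_getElem]
  intro i j k hij hjk hk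
  simp
  omega

lemma formPerm_range' {a n x : ℕ} (h1 : a ≤ x) (h2 : x < a + n) (hn : 0 < n) :
    List.formPerm ((a + n) :: List.range' a n) x = if x + 1 = a + n then a + n else x + 1 := by
  split_ifs with h
  · obtain ⟨n, rfl⟩ := Nat.exists_eq_succ_of_ne_zero hn.ne'
    rw [Nat.succ_eq_add_one, List.range'_1_concat]
    have : x = a + n := by omega
    rw [this, List.formPerm_cons_concat_apply_last]
  · have hd := nodup_cons_of_perm_range' (List.Perm.refl (List.range' a n))
    have := List.formPerm_apply_lt_getElem _ hd (x - a + 1) (by simp; omega)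
    simp at this
    rw [show a + (x - a) = x by omega] at this
    rw [this]; omega

lemma range'_mem_cycleTails (a n : ℕ) : List.range' a n ∈ cycleTails a n := by
  refine ⟨.refl _, listAvoids_range' a n, ?_⟩
  rintro i j k hi hij hjk hk ⟨h1, h2⟩
  have fi := formPerm_range' (a := a) (n := n) (x := i) (by omega) (by omega) (by omega)
  have fj := formPerm_range' (a := a) (n := n) (x := j) (by omega) (by omega) (by omega)
  obtain h | h : k < a + n ∨ k = a + n := by omega
  · have fk := formPerm_range' (a := a) (n := n) (x := k) (by omega) (by omega) (by omega)
    split_ifs at fi fj fk <;> omega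
  · obtain ⟨n, rfl⟩ := Nat.exists_eq_succ_of_ne_zero (show n ≠ 0 by omega)
    have hd := nodup_cons_of_perm_range' (List.Perm.refl (List.range' a (n + 1)))
    rw [Nat.succ_eq_add_one, List.range'_succ] at *
    rw [h, List.formPerm_apply_head _ _ _ hd] at h1
    split_ifs at fi fj <;> omega

lemma funAvoids_cons_iff {R : List ℕ} {a n : ℕ} (hR : R.Perm (List.range' a n))
    (ha : List.formPerm ((a + n) :: R) a = a + n) :
    FunAvoids (List.formPerm ((a + (n + 1)) :: (a + n) :: R)) a (n + 2) ↔
      FunAvoids (List.formPerm ((a + n) :: R)) a (n + 1) := by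
  have hm : List.formPerm ((a + (n + 1)) :: (a + n) :: R) (a + (n + 1)) = a + n := by
    apply List.formPerm_apply_head
    rw [List.nodup_cons]
    refine ⟨?_, nodup_cons_of_perm_range' hR⟩
    rw [List.mem_cons, mem_of_perm_range' hR]
    omega
  have hlt : ∀ x, a < x → x ≤ a + n → List.formPerm ((a + n) :: R) x < a + n := by
    intro x hx hx'
    have h1 : List.formPerm ((a + n) :: R) x ∈ (a + n) :: R := by
      apply List.formPerm_apply_mem_of_mem
      rw [List.mem_cons, mem_of_perm_range' hR]
      omega
    have h2 : List.formPerm ((a + n) :: R) x ≠ a + n := by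
      intro h
      have := (List.formPerm ((a + n) :: R)).injective (h.trans ha.symm)
      omega
    rw [List.mem_cons, mem_of_perm_range' hR] at h1
    omega
  have heq : ∀ x, a < x → x ≤ a + n →
      List.formPerm ((a + (n + 1)) :: (a + n) :: R) x = List.formPerm ((a + n) :: R) x := by
    intro x hx hx'
    have := hlt x hx hx'
    rw [List.formPerm_cons_cons, Equiv.Perm.mul_apply, Equiv.swap_apply_of_ne_of_ne] <;> omega
  have ha' : List.formPerm ((a + (n + 1)) :: (a + n) :: R) a = a + (n + 1) := by
    rw [List.formPerm_cons_cons, Equiv.Perm.mul_apply, ha, Equiv.swap_apply_right]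
  constructor
  · rintro h i j k hi hij hjk hk ⟨h1, h2⟩
    have hi' : a < i := by
      by_contra hh
      rw [show i = a by omega, ha] at h1
      have := hlt k (by omega) (by omega)
      omega
    apply h i j k hi hij hjk (by omega)
    rw [heq i hi' (by omega), heq j (by omega) (by omega), heq k (by omega) (by omega)]
    exact ⟨h1, h2⟩
  · rintro h i j k hi hij hjk hk ⟨h1, h2⟩
    have hj' := hlt j (by omega) (by omega)
    rw [heq j (by omega) (by omega)] at h2
    have hk' : k < a + (n + 1) := by
      by_contra hh
      rw [show k = a + (n + 1) by omega, hm] at h2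
      omega
    rw [heq k (by omega) (by omega)] at h1 h2
    have hi' : a < i := by
      by_contra hh
      rw [show i = a by omega, ha'] at h1
      omega
    rw [heq i (by omega) (by omega)] at h1
    exact h i j k hi hij hjk (by omega) ⟨h1, h2⟩

lemma formPerm_cons_append_pair {A : List ℕ} {a n : ℕ} (hA : A.Perm (List.range' (a + 1) n)) :
    List.formPerm ((a + (n + 2)) :: (A ++ [a + (n + 1), a])) a = a + (n + 2) ∧
    List.formPerm ((a + (n + 2)) :: (A ++ [a + (n + 1), a])) (a + (n + 1)) = a ∧
    List.formPerm ((a + (n + 2)) :: (A ++ [a + (n + 1), a])) (a + (n + 2)) =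
      List.formPerm ((a + 1 + n) :: A) (a + (n + 1)) ∧
    ∀ x, a < x → x < a + (n + 1) →
      List.formPerm ((a + (n + 2)) :: (A ++ [a + (n + 1), a])) x =
        List.formPerm ((a + 1 + n) :: A) x := by
  have hmem := mem_of_perm_range' hA
  have hn := nodup_of_perm_range' hA
  have hd : ((a + (n + 2)) :: (A ++ [a + (n + 1), a])).Nodup := by
    simp [List.nodup_append, hmem, hn]
    grind
  have h1 := formPerm_apply_append (s := (a + (n + 2)) :: A) (x := a + (n + 1)) (y := a) (t := [])
    hd
  have h0 : List.formPerm ((a + (n + 2)) :: (A ++ [a + (n + 1), a])) a = a + (n + 2) := by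
    have := List.formPerm_cons_concat_apply_last (a + (n + 2)) a (A ++ [a + (n + 1)])
    simpa using this
  refine ⟨h0, h1, ?_⟩
  have hrot : List.formPerm ((a + (n + 2)) :: (A ++ [a + (n + 1), a])) =
      List.formPerm ((a + (n + 1)) :: a :: (a + (n + 2)) :: A) := by
    apply List.formPerm_eq_of_isRotated hd
    have := (List.isRotated_append (l := (a + (n + 2)) :: A) (l' := [a + (n + 1), a]))
    simpa using this
  have hmem' : ∀ x ∈ A, List.formPerm A x ∈ A := fun x hx => List.formPerm_apply_mem_of_mem hx
  rw [hrot]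
  rcases A with _ | ⟨y, A⟩
  · simp at hA
    subst hA
    simp [Equiv.swap_apply_def]
    grind
  · have hy := (hmem y).1 (by simp)
    have hfix : ∀ x, x ∉ y :: A → List.formPerm (y :: A) x = x :=
      fun x hx => List.formPerm_apply_of_notMem hx
    rw [List.formPerm_cons_cons, List.formPerm_cons_cons, List.formPerm_cons_cons,
      List.formPerm_cons_cons]
    simp only [Equiv.Perm.mul_apply]
    constructor
    · rw [hfix _ (by rw [hmem]; omega), hfix _ (by rw [hmem]; omega)]
      simp [Equiv.swap_apply_def]
      grind
    · intro x hx hx'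
      have hx2 := hmem' x ((hmem x).2 (by omega))
      rw [hmem] at hx2
      simp only [Equiv.swap_apply_def]
      grind

lemma funAvoids_append_pair_iff {A : List ℕ} {a n : ℕ}
    (hA : A.Perm (List.range' (a + 1) n)) :
    FunAvoids (List.formPerm ((a + (n + 2)) :: (A ++ [a + (n + 1), a]))) a (n + 3) ↔
      FunAvoids (List.formPerm ((a + 1 + n) :: A)) (a + 1) (n + 1) := by
  obtain ⟨h1, h2, h3, h4⟩ := formPerm_cons_append_pair hA
  have hmem := mem_of_perm_range' hA
  have hmem' : ∀ x, a < x → x ≤ a + (n + 1) →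
      a < List.formPerm ((a + 1 + n) :: A) x ∧
      List.formPerm ((a + 1 + n) :: A) x ≤ a + (n + 1) := by
    intro x hx hx'
    have := List.formPerm_apply_mem_of_mem (l := (a + 1 + n) :: A) (x := x)
      (by rw [List.mem_cons, hmem]; omega)
    rw [List.mem_cons, hmem] at this
    omega
  generalize List.formPerm ((a + 1 + n) :: A) = g at *
  generalize List.formPerm ((a + (n + 2)) :: (A ++ [a + (n + 1), a])) = f at *
  constructor
  · rintro h i j k hi hij hjk hk ⟨h5, h6⟩
    obtain hk' | hk' : k < a + (n + 1) ∨ k = a + (n + 1) := by omega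
    · apply h i j k (by omega) hij hjk (by omega)
      rw [h4 i (by omega) (by omega), h4 j (by omega) (by omega), h4 k (by omega) (by omega)]
      exact ⟨h5, h6⟩
    · apply h i j (a + (n + 2)) (by omega) hij (by omega) (by omega)
      rw [h4 i (by omega) (by omega), h4 j (by omega) (by omega), h3, ← hk']
      exact ⟨h5, h6⟩
  · rintro h i j k hi hij hjk hk ⟨h5, h6⟩
    have hf : ∀ x, a < x → x < a + (n + 3) → a ≤ f x ∧ f x ≤ a + (n + 1) := by
      intro x hx hx'
      obtain hk' | hk' | hk' : x < a + (n + 1) ∨ x = a + (n + 1) ∨ x = a + (n + 2) := by omega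
      · have := hmem' x (by omega) (by omega)
        rw [h4 x (by omega) (by omega)]
        omega
      · rw [hk', h2]
        omega
      · have := hmem' (a + (n + 1)) (by omega) (by omega)
        rw [hk', h3]
        omega
    have hfk := hf k (by omega) (by omega)
    have hi' : i ≠ a := by intro hh; rw [hh] at h5; omega
    have hfi := hf i (by omega) (by omega)
    have hj' : j ≠ a + (n + 1) := by intro hh; rw [hh] at h6; omega
    have hk' : k ≠ a + (n + 1) := by intro hh; rw [hh] at h5; omega
    rw [h4 i (by omega) (by omega)] at h5
    rw [h4 j (by omega) (by omega)] at h6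
    obtain hk'' | rfl : k < a + (n + 1) ∨ k = a + (n + 2) := by omega
    · rw [h4 k (by omega) (by omega)] at h5 h6
      exact h i j k (by omega) hij hjk (by omega) ⟨h5, h6⟩
    · rw [h3] at h5 h6
      exact h i j (a + (n + 1)) (by omega) hij (by omega) (by omega) ⟨h5, h6⟩

lemma listAvoids_cons_iff {M : ℕ} {R : List ℕ} (h : ∀ x ∈ R, x < M) :
    ListAvoids (M :: R) ↔ ListAvoids R := by
  unfold ListAvoids
  rw [List.triplewise_cons, and_iff_right]
  rw [List.pairwise_iff_getElem]
  intro i j hi hj hij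
  have := h _ (List.getElem_mem hj)
  omega

lemma listAvoids_append_pair_iff {M a : ℕ} {A : List ℕ} (hM : ∀ x ∈ A, x < M)
    (ha : ∀ x ∈ A, a < x) : ListAvoids (A ++ [M, a]) ↔ ListAvoids A := by
  unfold ListAvoids
  rw [List.triplewise_append]
  have h1 : ∀ y ∈ A, List.Pairwise (fun x z => ¬ (y < z ∧ z < x)) [M, a] := by
    intro y hy
    have := ha y hy
    simp
    omega
  have h2 : ∀ z ∈ [M, a], List.Pairwise (fun x y => ¬ (x < z ∧ z < y)) A := by
    intro z hz
    rw [List.pairwise_iff_getElem]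
    intro i j hi hj hij
    have := hM _ (List.getElem_mem hj)
    have := ha _ (List.getElem_mem hi)
    simp at hz
    omega
  simp only [List.triplewise_pair, true_and]
  exact ⟨fun h => h.1, fun h => ⟨h, h1, h2⟩⟩

lemma ListAvoids.lt_of_append {A B : List ℕ} {M x y : ℕ} (h : ListAvoids (A ++ M :: B))
    (hM : y < M) (hx : x ∈ A) (hy : y ∈ B) : y ≤ x := by
  unfold ListAvoids at h
  rw [List.triplewise_append] at h
  have h1 := h.2.2.1 x hx
  rw [List.pairwise_cons] at h1
  have := h1.1 y hy
  omega

lemma cons_mem_cycleTails {a n : ℕ} {R : List ℕ} (hR : R.Perm (List.range' a n))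
    (ha : List.formPerm ((a + n) :: R) a = a + n) :
    (a + n) :: R ∈ cycleTails a (n + 1) ↔ R ∈ cycleTails a n := by
  have h1 : ((a + n) :: R).Perm (List.range' a (n + 1)) := by
    rw [List.range'_1_concat]
    exact (List.Perm.cons _ hR).trans (List.perm_append_singleton _ _).symm
  have h2 : ListAvoids ((a + n) :: R) ↔ ListAvoids R :=
    listAvoids_cons_iff fun x hx => ((mem_of_perm_range' hR x).1 hx).2
  simp only [cycleTails, Set.mem_ofPred_eq, hR, h1, h2, true_and]
  rw [← funAvoids_cons_iff hR ha]

lemma append_pair_mem_cycleTails {a n : ℕ} {A : List ℕ} (hA : A.Perm (List.range' (a + 1) n)) :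
    A ++ [a + (n + 1), a] ∈ cycleTails a (n + 2) ↔ A ∈ cycleTails (a + 1) n := by
  have hmem := mem_of_perm_range' hA
  have h1 : (A ++ [a + (n + 1), a]).Perm (List.range' a (n + 2)) := by
    apply perm_range'_of
    · simp [List.nodup_append, hmem, nodup_of_perm_range' hA]
      grind
    · simp [hmem]
      grind
  have h2 : ListAvoids (A ++ [a + (n + 1), a]) ↔ ListAvoids A := by
    apply listAvoids_append_pair_iff
    all_goals
      intro x hx
      rw [hmem] at hx
      omega
  simp only [cycleTails, Set.mem_ofPred_eq, hA, h1, h2, true_and]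
  rw [← funAvoids_append_pair_iff hA]

lemma nil_mem_cycleTails (a : ℕ) : [] ∈ cycleTails a 0 := range'_mem_cycleTails a 0

lemma eq_range'_of_append_singleton {a n : ℕ} {A : List ℕ}
    (h : A ++ [a + (n + 1)] ∈ cycleTails a (n + 2)) :
    A ++ [a + (n + 1)] = List.range' a (n + 2) := by
  obtain ⟨hp, hL, hF⟩ := h
  have hM : List.formPerm ((a + (n + 2)) :: (A ++ [a + (n + 1)])) (a + (n + 1)) = a + (n + 2) :=
    List.formPerm_cons_concat_apply_last _ _ _
  have hd := nodup_cons_of_perm_range' hp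
  generalize A ++ [a + (n + 1)] = R at *
  have hmem : ∀ x, x ∈ (a + (n + 2)) :: R ↔ a ≤ x ∧ x ≤ a + (n + 2) := by
    intro x
    rw [List.mem_cons, mem_of_perm_range' hp]
    omega
  have hm : List.formPerm ((a + (n + 2)) :: R) (a + (n + 2)) = a := by
    by_contra hne
    obtain ⟨i, hi⟩ := (List.formPerm ((a + (n + 2)) :: R)).surjective a
    have hi2 : a ≤ i ∧ i ≤ a + (n + 2) := by
      rw [← hmem]
      apply List.mem_of_formPerm_apply_mem
      rw [hi, hmem]
      omega
    have hi3 : i ≠ a + (n + 2) := by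
      rintro rfl
      exact hne hi
    have hi4 : i ≠ a + (n + 1) := by
      rintro rfl
      omega
    have h5 := (hmem _).1 (List.formPerm_apply_mem_of_mem ((hmem (a + (n + 2))).2 (by omega)))
    have h6 := (List.formPerm ((a + (n + 2)) :: R)).injective.ne
      (show a + (n + 2) ≠ a + (n + 1) by omega)
    apply hF i (a + (n + 1)) (a + (n + 2)) <;> omega
  rcases R with _ | ⟨y, R⟩
  · simp at hp
  · rw [List.formPerm_apply_head _ _ _ hd] at hm
    subst hm
    have hs : R.Pairwise (· ≤ ·) := by
      unfold ListAvoids at hL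
      rw [List.triplewise_cons, List.pairwise_iff_getElem] at hL
      rw [List.pairwise_iff_getElem]
      intro i j hi hj hij
      have h1 := hL.1 i j hi hj hij
      have h2 := (mem_of_perm_range' hp R[j]).1 (by simp)
      have h3 : R[j] ≠ y := by
        have := hd.of_cons.notMem
        intro h
        apply this
        rw [← h]
        simp
      omega
    apply hp.eq_of_sortedLE
    · rw [List.sortedLE_iff_pairwise, List.pairwise_cons]
      refine ⟨fun x hx => ?_, hs⟩
      exact ((mem_of_perm_range' hp x).1 (by simp [hx])).1
    · rw [List.sortedLE_iff_pairwise]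
      exact (List.pairwise_lt_range' ).imp fun h => h.le

lemma cycleTails_cases {a n : ℕ} {R : List ℕ} (h : R ∈ cycleTails a (n + 2)) :
    R = List.range' a (n + 2) ∨
    (∃ R' ∈ cycleTails a (n + 1), R' ≠ List.range' a (n + 1) ∧ R = (a + (n + 1)) :: R' ∧
      List.formPerm ((a + (n + 1)) :: R') a = a + (n + 1)) ∨
    ∃ A ∈ cycleTails (a + 1) n, R = A ++ [a + (n + 1), a] := by
  have hR := h
  obtain ⟨hp, hL, hF⟩ := h
  have hmemR := mem_of_perm_range' hp
  obtain ⟨A, B, rfl⟩ := List.append_of_mem ((hmemR (a + (n + 1))).2 (by omega))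
  have hd := nodup_cons_of_perm_range' hp
  have hmem : ∀ x, x ∈ (a + (n + 2)) :: (A ++ (a + (n + 1)) :: B) ↔ a ≤ x ∧ x ≤ a + (n + 2) := by
    intro x
    rw [List.mem_cons, hmemR]
    omega
  rcases List.eq_nil_or_concat' B with rfl | ⟨B, p, rfl⟩
  · exact .inl (eq_range'_of_append_singleton hR)
  right
  have hfp : List.formPerm ((a + (n + 2)) :: (A ++ (a + (n + 1)) :: (B ++ [p]))) p =
      a + (n + 2) := by
    have := List.formPerm_cons_concat_apply_last (a + (n + 2)) p (A ++ (a + (n + 1)) :: B)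
    simpa using this
  have hpb := (hmemR p).1 (by simp)
  have hpM : p ≠ a + (n + 1) := by
    simp [List.nodup_append] at hd
    grind
  rcases List.eq_nil_or_concat' A with rfl | ⟨A, q, rfl⟩
  · have hfm : List.formPerm ((a + (n + 2)) :: ([] ++ (a + (n + 1)) :: (B ++ [p])))
        (a + (n + 2)) = a + (n + 1) := List.formPerm_apply_head _ _ _ hd
    have hpa : p = a := by
      by_contra hpa
      have h1 := (hmem _).1 (List.formPerm_apply_mem_of_mem ((hmem a).2 (by omega)))
      have h2 := (List.formPerm ((a + (n + 2)) :: ([] ++ (a + (n + 1)) :: (B ++ [p])))).injective.ne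
        (show a ≠ p by omega)
      have h3 := (List.formPerm ((a + (n + 2)) :: ([] ++ (a + (n + 1)) :: (B ++ [p])))).injective.ne
        (show a ≠ a + (n + 2) by omega)
      apply hF a p (a + (n + 2)) <;> omega
    subst hpa
    by_cases hB : B = []
    · subst hB
      have := hp.length_eq
      simp at this
      subst this
      exact .inr ⟨[], nil_mem_cycleTails _, by simp⟩
    · left
      have hp' : (B ++ [p]).Perm (List.range' p (n + 1)) := by
        apply perm_range'_of
        · rw [List.nil_append] at hd
          exact hd.of_cons.of_cons
        · intro x
          have h1 := hmemR x
          have h2 := hd.of_cons.notMem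
          rw [List.nil_append, List.mem_cons] at h1
          by_cases hx : x = p + (n + 1)
          · rw [hx]
            simp only [h2, false_iff]
            omega
          · grind
      have h1 := List.formPerm_cons_concat_apply_last (p + (n + 1)) p B
      refine ⟨B ++ [p], (cons_mem_cycleTails hp' h1).1 hR, ?_, rfl, h1⟩
      intro h
      rw [List.range'_1_concat] at h
      have h2 := List.append_inj_right' h rfl
      simp at h2
      subst h2
      simp at h
      exact hB h
  · right
    have hfq : List.formPerm ((a + (n + 2)) :: ((A ++ [q]) ++ (a + (n + 1)) :: (B ++ [p]))) q =
        a + (n + 1) := by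
      have := formPerm_apply_append (s := (a + (n + 2)) :: A) (x := q) (y := a + (n + 1))
        (t := B ++ [p]) (by simpa using hd)
      simpa using this
    have hqb := (hmemR q).1 (by simp)
    have hpq : p ≠ q := by
      simp [List.nodup_append] at hd
      grind
    have hqM : q ≠ a + (n + 1) := by
      simp [List.nodup_append] at hd
      grind
    have hpq' : p ≤ q := hL.lt_of_append (by omega) (by simp) (by simp)
    have hpa : p = a := by
      by_contra hpa
      have h1 := (hmem _).1 (List.formPerm_apply_mem_of_mem ((hmem a).2 (by omega)))
      have h2 := (List.formPerm ((a + (n + 2)) ::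
        ((A ++ [q]) ++ (a + (n + 1)) :: (B ++ [p])))).injective.ne (show a ≠ p by omega)
      have h3 := (List.formPerm ((a + (n + 2)) ::
        ((A ++ [q]) ++ (a + (n + 1)) :: (B ++ [p])))).injective.ne (show a ≠ q by omega)
      apply hF a p q <;> omega
    subst hpa
    rcases List.eq_nil_or_concat' B with rfl | ⟨B, v, rfl⟩
    · have hA : (A ++ [q]).Perm (List.range' (p + 1) n) := by
        apply perm_range'_of
        · exact (List.nodup_append.1 hd.of_cons).1
        · intro x
          have h1 := hmemR x
          simp [List.nodup_append] at hd h1 ⊢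
          grind
      exact ⟨A ++ [q], (append_pair_mem_cycleTails hA).1 hR, rfl⟩
    · exfalso
      have hfv : List.formPerm ((p + (n + 2)) ::
          ((A ++ [q]) ++ (p + (n + 1)) :: ((B ++ [v]) ++ [p]))) v = p := by
        have := formPerm_apply_append (s := (p + (n + 2)) :: (A ++ [q] ++ (p + (n + 1)) :: B))
          (x := v) (y := p) (t := []) (by simpa using hd)
        simpa using this
      have hvb := (hmemR v).1 (by simp)
      have hvM : v ≠ p + (n + 1) := by
        simp [List.nodup_append] at hd
        grind
      have hvq : v ≠ q := by
        simp [List.nodup_append] at hd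
        grind
      have hvq' : v ≤ q := hL.lt_of_append (by omega) (by simp) (by simp)
      have h1 := (hmem _).1 (List.formPerm_apply_mem_of_mem ((hmem (p + (n + 2))).2 (by omega)))
      have hne {x : ℕ} (hx : p + (n + 2) ≠ x) := (List.formPerm ((p + (n + 2)) ::
        ((A ++ [q]) ++ (p + (n + 1)) :: ((B ++ [v]) ++ [p])))).injective.ne hx
      have h2 := hne (show p + (n + 2) ≠ v by omega)
      have h3 := hne (show p + (n + 2) ≠ q by omega)
      have h4 := hne (show p + (n + 2) ≠ p by omega)
      apply hF v q (p + (n + 2)) <;> omega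

lemma cycleTails_zero (a : ℕ) : cycleTails a 0 = {[]} := by
  ext R
  constructor
  · rintro ⟨h, -⟩
    simpa using h
  · rintro rfl
    exact nil_mem_cycleTails a

lemma cycleTails_one (a : ℕ) : cycleTails a 1 = {[a]} := by
  ext R
  constructor
  · rintro ⟨h, -⟩
    simpa using h
  · rintro rfl
    exact range'_mem_cycleTails a 1

lemma formPerm_apply_of_mem_cycleTails {a n : ℕ} {R : List ℕ} (h : R ∈ cycleTails a n)
    (hne : R ≠ List.range' a n) : List.formPerm ((a + n) :: R) a = a + n := by
  obtain _ | _ | n := n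
  · rw [cycleTails_zero] at h
    simp_all
  · rw [cycleTails_one] at h
    simp_all
  · obtain h | ⟨R', hR', -, rfl, ha⟩ | ⟨A, hA, rfl⟩ := cycleTails_cases h
    · exact absurd h hne
    · rw [List.formPerm_cons_cons, Equiv.Perm.mul_apply, ha]
      exact Equiv.swap_apply_right _ _
    · exact (formPerm_cons_append_pair hA.1).1

lemma cycleTails_eq (a n : ℕ) : cycleTails a (n + 2) =
    insert (List.range' a (n + 2))
      ((fun R => (a + (n + 1)) :: R) '' (cycleTails a (n + 1) \ {List.range' a (n + 1)}) ∪
        (fun A => A ++ [a + (n + 1), a]) '' cycleTails (a + 1) n) := by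
  ext R
  rw [Set.mem_insert_iff, Set.mem_union]
  constructor
  · intro h
    obtain h | ⟨R', hR', h1, rfl, ha⟩ | ⟨A, hA, rfl⟩ := cycleTails_cases h
    · exact .inl h
    · exact .inr (.inl ⟨R', ⟨hR', h1⟩, rfl⟩)
    · exact .inr (.inr ⟨A, hA, rfl⟩)
  · rintro (rfl | ⟨R', ⟨hR', h1⟩, rfl⟩ | ⟨A, hA, rfl⟩)
    · exact range'_mem_cycleTails _ _
    · exact (cons_mem_cycleTails hR'.1 (formPerm_apply_of_mem_cycleTails hR' h1)).2 hR'
    · exact (append_pair_mem_cycleTails hA.1).2 hA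

lemma ncard_cycleTails_add_two (a n : ℕ) : (cycleTails a (n + 2)).ncard =
    (cycleTails a (n + 1)).ncard + (cycleTails (a + 1) n).ncard := by
  have hf1 := finite_cycleTails a (n + 1)
  have hf2 := finite_cycleTails (a + 1) n
  rw [cycleTails_eq, Set.ncard_insert_of_notMem _ ((hf1.sdiff.image _).union (hf2.image _)),
    Set.ncard_union_eq _ (hf1.sdiff.image _) (hf2.image _),
    Set.ncard_image_of_injective _ (fun _ _ h => (List.cons.inj h).2),
    Set.ncard_image_of_injective _ (List.append_left_injective _)]
  · have := Set.ncard_sdiff_singleton_add_one (range'_mem_cycleTails a (n + 1)) hf1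
    omega
  · rw [Set.disjoint_left]
    rintro _ ⟨R, ⟨hR, hne⟩, rfl⟩ ⟨A, hA, h⟩
    rcases A with _ | ⟨x, A⟩
    · have := hA.1.length_eq
      simp at this
      subst this
      simp at h
      exact hne (by simp [← h])
    · simp only [List.cons_append, List.cons.injEq] at h
      have := (mem_of_perm_range' hA.1 x).1 (by simp)
      omega
  · rintro (⟨R, ⟨hR, hne⟩, h⟩ | ⟨A, hA, h⟩)
    · rw [List.range'_succ] at h
      simp at h
    · have := congrArg List.getLast? h
      rw [List.range'_1_concat] at this
      simp at this

lemma ncard_cycleTails (a n : ℕ) : (cycleTails a n).ncard = Nat.fib (n + 1) := by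
  induction n using Nat.twoStepInduction generalizing a with
  | zero => simp [cycleTails_zero]
  | one => simp [cycleTails_one]
  | more n ih1 ih2 =>
    rw [ncard_cycleTails_add_two, ih1, ih2, Nat.fib_add_two (n := n + 1), add_comm]

open Function in
/-- The orbit `x, f x, f (f x), …` of a periodic point, listed once. -/
noncomputable def cycleWord {α : Type*} (f : α → α) (x : α) : List α :=
  (List.range (minimalPeriod f x)).map fun k => f^[k] x

open Classical in
/-- The standard cycle form, with parentheses erased, of `f` on the `n` points `a, a + 1, …`. -/
noncomputable def cycleFormWord (f : ℕ → ℕ) (a n : ℕ) : List ℕ :=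
  ((List.range' a n).filter fun x => decide (∀ k, f^[k] x ≤ x)).flatMap (cycleWord f)

/-- `f` fixes every point outside the `n` points `a, a + 1, …`. -/
def FixesOutside (f : Equiv.Perm ℕ) (a n : ℕ) : Prop :=
  ∀ x, ¬ (a ≤ x ∧ x < a + n) → f x = x

/-- The permutations of `a, a + 1, …, a + n - 1` avoiding 132 together with their images
under the fundamental bijection. -/
def doublyAvoiding (a n : ℕ) : Set (Equiv.Perm ℕ) :=
  {f | FixesOutside f a n ∧ FunAvoids f a n ∧ ListAvoids (cycleFormWord f a n)}

lemma finite_doublyAvoiding (a n : ℕ) : (doublyAvoiding a n).Finite := by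
  have h1 : Finite {x // a ≤ x ∧ x < a + n} := (Set.finite_Ico a (a + n)).to_subtype
  have h2 : Finite {f : Equiv.Perm ℕ // ∀ x, ¬ (a ≤ x ∧ x < a + n) → f x = x} :=
    Finite.of_equiv _ (Equiv.Perm.subtypeEquivSubtypePerm fun x => a ≤ x ∧ x < a + n)
  have h3 : {f | FixesOutside f a n}.Finite := @Set.toFinite _ _ h2
  exact h3.subset fun f hf => hf.1

namespace FixesOutside

variable {f : Equiv.Perm ℕ} {a n : ℕ}

lemma apply_mem (h : FixesOutside f a n) {x : ℕ} (hx : a ≤ x ∧ x < a + n) :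
    a ≤ f x ∧ f x < a + n := by
  by_contra hc
  have := f.injective (h _ hc)
  rw [this] at hc
  exact hc hx

lemma mem_of_apply_mem (h : FixesOutside f a n) {x : ℕ} (hx : a ≤ f x ∧ f x < a + n) :
    a ≤ x ∧ x < a + n := by
  by_contra hc
  rw [h _ hc] at hx
  exact hc hx

lemma iterate_mem (h : FixesOutside f a n) {x : ℕ} (hx : a ≤ x ∧ x < a + n) (k : ℕ) :
    a ≤ f^[k] x ∧ f^[k] x < a + n := by
  induction k with
  | zero => exact hx
  | succ k ih =>
    rw [Function.iterate_succ_apply']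
    exact h.apply_mem ih

lemma mem_periodicPts (h : FixesOutside f a n) (x : ℕ) : x ∈ Function.periodicPts f := by
  by_cases hx : a ≤ x ∧ x < a + n
  · obtain ⟨i, j, hij, he⟩ := (Set.finite_Ico a (a + n)).exists_lt_map_eq_of_forall_mem
      (f := fun k => f^[k] x) (fun k => h.iterate_mem hx k)
    refine ⟨j - i, by omega, ?_⟩
    apply f.injective.iterate i
    rw [← Function.iterate_add_apply, show i + (j - i) = j by omega, he]
  · exact ⟨1, one_pos, h x hx⟩

lemma minimalPeriod_pos (h : FixesOutside f a n) (x : ℕ) : 0 < Function.minimalPeriod f x :=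
  Function.minimalPeriod_pos_of_mem_periodicPts (h.mem_periodicPts x)

lemma mem_cycleWord (h : FixesOutside f a n) {x z : ℕ} :
    z ∈ cycleWord f x ↔ ∃ k, f^[k] x = z := by
  unfold cycleWord
  simp only [List.mem_map, List.mem_range]
  constructor
  · rintro ⟨k, -, hk⟩
    exact ⟨k, hk⟩
  · rintro ⟨k, hk⟩
    refine ⟨k % Function.minimalPeriod f x, Nat.mod_lt _ (h.minimalPeriod_pos x), ?_⟩
    rw [Function.iterate_mod_minimalPeriod_eq, hk]

lemma exists_iterate_symm (h : FixesOutside f a n) {x z : ℕ} (hz : ∃ k, f^[k] x = z) :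
    ∃ k, f^[k] z = x := by
  rw [← h.mem_cycleWord] at hz
  simp only [cycleWord, List.mem_map, List.mem_range] at hz
  obtain ⟨k, hk, rfl⟩ := hz
  refine ⟨Function.minimalPeriod f x - k, ?_⟩
  rw [← Function.iterate_add_apply, Nat.sub_add_cancel hk.le, Function.iterate_minimalPeriod]

lemma apply_mem_cycleWord (h : FixesOutside f a n) {x z : ℕ} :
    f z ∈ cycleWord f x ↔ z ∈ cycleWord f x := by
  rw [h.mem_cycleWord, h.mem_cycleWord]
  constructor
  · intro hz
    obtain ⟨k, hk⟩ := h.exists_iterate_symm hz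
    apply h.exists_iterate_symm
    exact ⟨k + 1, hk⟩
  · rintro ⟨k, rfl⟩
    exact ⟨k + 1, Function.iterate_succ_apply' _ _ _⟩

lemma exists_cycleWord_eq_cons (h : FixesOutside f a n) (x : ℕ) :
    ∃ R, cycleWord f x = x :: R := by
  unfold cycleWord
  obtain ⟨k, hk⟩ := Nat.exists_eq_succ_of_ne_zero (h.minimalPeriod_pos x).ne'
  rw [hk, Nat.succ_eq_add_one, List.range_succ_eq_map]
  exact ⟨_, rfl⟩

end FixesOutside

lemma nodup_cycleWord {α : Type*} (f : α → α) (x : α) : (cycleWord f x).Nodup := by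
  unfold cycleWord
  apply List.Nodup.map_on _ List.nodup_range
  intro i hi j hj hij
  rw [List.mem_range] at hi hj
  exact (Function.iterate_eq_iterate_iff_of_lt_minimalPeriod hi hj).1 hij

namespace FixesOutside

variable {f : Equiv.Perm ℕ} {a n : ℕ}

lemma mem_cycleFormWord (h : FixesOutside f a n) (x : ℕ) :
    x ∈ cycleFormWord f a n ↔ a ≤ x ∧ x < a + n := by
  classical
  simp only [cycleFormWord, List.mem_flatMap, List.mem_filter, decide_eq_true_eq,
    List.mem_range'_1, h.mem_cycleWord]
  constructor
  · rintro ⟨y, ⟨hy, -⟩, k, rfl⟩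
    exact h.iterate_mem hy k
  · intro hx
    have hfin : (Set.range fun k => f^[k] x).Finite := by
      apply (Set.finite_Ico a (a + n)).subset
      rintro _ ⟨k, rfl⟩
      exact h.iterate_mem hx k
    obtain ⟨y, ⟨k, hk⟩, hmax⟩ := hfin.exists_le_maximal (a := x) ⟨0, rfl⟩ |>.imp fun y h => h.2
    simp only at hk
    refine ⟨y, ⟨hk ▸ h.iterate_mem hx k, fun j => ?_⟩, h.exists_iterate_symm ⟨k, hk⟩⟩
    by_contra hc
    exact hc (hmax ⟨j + k, by simp only; rw [Function.iterate_add_apply, hk]⟩ (not_le.1 hc).le)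

lemma nodup_cycleFormWord (h : FixesOutside f a n) : (cycleFormWord f a n).Nodup := by
  classical
  unfold cycleFormWord
  rw [List.nodup_flatMap]
  refine ⟨fun x _ => nodup_cycleWord _ _, ?_⟩
  apply (List.Nodup.filter _ List.nodup_range').pairwise_of_forall_ne
  intro x hx y hy hxy z hzx hzy
  simp only [List.mem_filter, decide_eq_true_eq] at hx hy
  rw [h.mem_cycleWord] at hzx hzy
  apply hxy
  obtain ⟨i, hi⟩ := hzx
  obtain ⟨j, hj⟩ := hzy
  obtain ⟨i', hi'⟩ := h.exists_iterate_symm ⟨i, hi⟩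
  obtain ⟨j', hj'⟩ := h.exists_iterate_symm ⟨j, hj⟩
  have h1 := hx.2 (j' + i)
  have h2 := hy.2 (i' + j)
  rw [Function.iterate_add_apply, hi, hj'] at h1
  rw [Function.iterate_add_apply, hj, hi'] at h2
  omega

lemma cycleFormWord_succ (h : FixesOutside f a (n + 1)) :
    cycleFormWord f a (n + 1) = cycleFormWord f a n ++ cycleWord f (a + n) := by
  classical
  unfold cycleFormWord
  have : ∀ k, f^[k] (a + n) ≤ a + n := fun k => by
    have := h.iterate_mem (x := a + n) (by omega) k
    omega
  rw [List.range'_1_concat, List.filter_append, List.flatMap_append]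
  simp [this]

end FixesOutside

lemma cycleWord_of_fixed {α : Type*} {f : α → α} {x : α} (h : f x = x) : cycleWord f x = [x] := by
  have : Function.minimalPeriod f x = 1 := Function.minimalPeriod_eq_one_iff_isFixedPt.2 h
  simp [cycleWord, this]

lemma listAvoids_append_singleton_iff {M : ℕ} {A : List ℕ} (hM : ∀ x ∈ A, x < M) :
    ListAvoids (A ++ [M]) ↔ ListAvoids A := by
  unfold ListAvoids
  rw [List.triplewise_append]
  have h2 : ∀ z ∈ [M], List.Pairwise (fun x y => ¬ (x < z ∧ z < y)) A := by
    intro z hz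
    rw [List.pairwise_iff_getElem]
    intro i j hi hj hij
    have := hM _ (List.getElem_mem hj)
    simp at hz
    omega
  exact ⟨fun h => h.1, fun h => ⟨h, List.triplewise_singleton _ _, by simp, h2⟩⟩

lemma fixesOutside_succ_iff {f : Equiv.Perm ℕ} {a n : ℕ} (hf : f (a + n) = a + n) :
    FixesOutside f a (n + 1) ↔ FixesOutside f a n := by
  constructor
  · intro h x hx
    by_cases hx' : x = a + n
    · rw [hx', hf]
    · exact h x (by omega)
  · intro h x hx
    exact h x (by omega)

lemma setOf_last_fixed (a n : ℕ) :
    {f ∈ doublyAvoiding a (n + 1) | f (a + n) = a + n} = doublyAvoiding a n := by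
  have key : ∀ f : Equiv.Perm ℕ, f (a + n) = a + n →
      (f ∈ doublyAvoiding a (n + 1) ↔ f ∈ doublyAvoiding a n) := by
    intro f hf
    unfold doublyAvoiding
    rw [Set.mem_ofPred_eq, Set.mem_ofPred_eq, fixesOutside_succ_iff hf]
    apply and_congr_right
    intro h
    have h' := (fixesOutside_succ_iff hf).2 h
    rw [h'.cycleFormWord_succ, cycleWord_of_fixed hf,
      listAvoids_append_singleton_iff fun x hx => ((h.mem_cycleFormWord x).1 hx).2]
    apply and_congr_left
    intro _
    constructor
    · intro hF i j k hi hij hjk hk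
      exact hF i j k hi hij hjk (by omega)
    · rintro hF i j k hi hij hjk hk ⟨h1, h2⟩
      obtain hk' | rfl : k < a + n ∨ k = a + n := by omega
      · exact hF i j k hi hij hjk hk' ⟨h1, h2⟩
      · have := h.apply_mem (x := j) (by omega)
        omega
  ext f
  constructor
  · rintro ⟨h1, h2⟩
    exact (key f h2).1 h1
  · intro h
    have hf : f (a + n) = a + n := h.1 _ (by omega)
    exact ⟨(key f hf).2 h, hf⟩

lemma cycleWord_formPerm {x : ℕ} {R : List ℕ} (h : (x :: R).Nodup) :
    cycleWord (List.formPerm (x :: R)) x = x :: R := by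
  have hit : ∀ k, (List.formPerm (x :: R))^[k] x =
      (x :: R)[k % (x :: R).length]'(Nat.mod_lt _ (Nat.zero_lt_succ _)) := by
    intro k
    rw [← List.formPerm_pow_apply_head x R h, Equiv.Perm.coe_pow]
  have hp : Function.IsPeriodicPt (List.formPerm (x :: R)) (x :: R).length x := by
    change (List.formPerm (x :: R))^[(x :: R).length] x = x
    rw [hit]
    simp
  have hpos := hp.minimalPeriod_pos (by simp)
  have hle := hp.minimalPeriod_le (by simp)
  have hmin : Function.minimalPeriod (List.formPerm (x :: R)) x = (x :: R).length := by
    by_contra hne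
    have h1 := hit (Function.minimalPeriod (List.formPerm (x :: R)) x)
    rw [Function.iterate_minimalPeriod] at h1
    have h2 : (x :: R)[0] = (x :: R)[Function.minimalPeriod (List.formPerm (x :: R)) x] := by
      simp only [Nat.mod_eq_of_lt (lt_of_le_of_ne hle hne)] at h1
      exact h1
    rw [h.getElem_inj_iff] at h2
    omega
  apply List.ext_getElem
  · simp [cycleWord, hmin]
  · intro k h1 h2
    simp only [cycleWord, List.getElem_map, List.getElem_range, hit, Nat.mod_eq_of_lt h2]

lemma FixesOutside.formPerm_cycleWord {f : Equiv.Perm ℕ} {a n x : ℕ} (h : FixesOutside f a n)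
    (hx : ∀ z, a ≤ z ∧ z < a + n → z ∈ cycleWord f x) :
    List.formPerm (cycleWord f x) = f := by
  ext z
  by_cases hz : z ∈ cycleWord f x
  · have hlen : (cycleWord f x).length = Function.minimalPeriod f x := by simp [cycleWord]
    obtain ⟨k, hk, rfl⟩ := List.getElem_of_mem hz
    rw [List.formPerm_apply_getElem _ (nodup_cycleWord _ _)]
    simp only [cycleWord, List.getElem_map, List.getElem_range, List.length_map, List.length_range]
    rw [Function.iterate_mod_minimalPeriod_eq, Function.iterate_succ_apply']
  · rw [List.formPerm_apply_of_notMem hz, h]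
    exact fun hc => hz (hx z hc)

lemma FixesOutside.cycleFormWord_of_cyclic {f : Equiv.Perm ℕ} {a n : ℕ}
    (h : FixesOutside f a (n + 1))
    (hx : ∀ z, a ≤ z ∧ z < a + (n + 1) → z ∈ cycleWord f (a + n)) :
    cycleFormWord f a (n + 1) = cycleWord f (a + n) := by
  have hd := h.nodup_cycleFormWord
  have hm := h.mem_cycleFormWord
  rw [h.cycleFormWord_succ] at hd hm ⊢
  have : cycleFormWord f a n = [] := by
    rw [List.eq_nil_iff_forall_not_mem]
    intro z hz
    exact (List.nodup_append.1 hd).2.2 z hz z (hx z ((hm z).1 (by simp [hz]))) rfl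
  simp [this]

lemma setOf_cyclic (a n : ℕ) :
    {f ∈ doublyAvoiding a (n + 1) | ∀ z, a ≤ z ∧ z < a + (n + 1) → z ∈ cycleWord f (a + n)} =
      (fun R => List.formPerm ((a + n) :: R)) '' cycleTails a n := by
  ext f
  constructor
  · rintro ⟨⟨hs, hF, hL⟩, hc⟩
    obtain ⟨R, hR⟩ := hs.exists_cycleWord_eq_cons (a + n)
    have hf := hs.formPerm_cycleWord hc
    have hw := hs.cycleFormWord_of_cyclic hc
    have hd := nodup_cycleWord f (a + n)
    have hm := hs.mem_cycleFormWord
    rw [hw] at hL hm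
    rw [hR] at hf hd hL hm
    have hp : R.Perm (List.range' a n) := by
      apply perm_range'_of hd.of_cons
      intro x
      have h1 := hm x
      have h2 := hd.notMem
      by_cases hx : x = a + n
      · rw [hx]
        simp only [h2, false_iff]
        omega
      · rw [List.mem_cons] at h1
        grind
    rw [listAvoids_cons_iff fun x hx => ((mem_of_perm_range' hp x).1 hx).2] at hL
    exact ⟨R, ⟨hp, hL, by rwa [hf]⟩, hf⟩
  · rintro ⟨R, ⟨hp, hL, hF⟩, rfl⟩
    simp only
    have hd := nodup_cons_of_perm_range' hp
    have hw := cycleWord_formPerm hd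
    have hm : ∀ x, x ∈ (a + n) :: R ↔ a ≤ x ∧ x < a + (n + 1) := by
      intro x
      rw [List.mem_cons, mem_of_perm_range' hp]
      omega
    have hs : FixesOutside (List.formPerm ((a + n) :: R)) a (n + 1) := by
      intro x hx
      apply List.formPerm_apply_of_notMem
      rwa [hm]
    have hc : ∀ z, a ≤ z ∧ z < a + (n + 1) →
        z ∈ cycleWord (List.formPerm ((a + n) :: R)) (a + n) := by
      intro z hz
      rwa [hw, hm]
    refine ⟨⟨hs, hF, ?_⟩, hc⟩
    rw [hs.cycleFormWord_of_cyclic hc, hw]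
    exact (listAvoids_cons_iff fun x hx => ((mem_of_perm_range' hp x).1 hx).2).2 hL

lemma ncard_setOf_cyclic (a n : ℕ) :
    {f ∈ doublyAvoiding a (n + 1) |
      ∀ z, a ≤ z ∧ z < a + (n + 1) → z ∈ cycleWord f (a + n)}.ncard = Nat.fib (n + 1) := by
  rw [setOf_cyclic, Set.InjOn.ncard_image, ncard_cycleTails]
  intro R hR S hS h
  have h1 := cycleWord_formPerm (nodup_cons_of_perm_range' hR.1)
  have h2 := cycleWord_formPerm (nodup_cons_of_perm_range' hS.1)
  simp only at h
  rw [h, h2] at h1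
  exact (List.cons.inj h1).2.symm

section SwapEnds

variable {f g : Equiv.Perm ℕ} {a n : ℕ}

lemma fixesOutside_iff_of_swap (h3 : g a = a) (h4 : g (a + (n + 1)) = a + (n + 1))
    (h5 : ∀ x, x ≠ a → x ≠ a + (n + 1) → f x = g x) :
    FixesOutside f a (n + 2) ↔ FixesOutside g (a + 1) n := by
  constructor
  · intro h x hx
    by_cases hxa : x = a
    · rw [hxa, h3]
    by_cases hxm : x = a + (n + 1)
    · rw [hxm, h4]
    rw [← h5 x hxa hxm]
    exact h x (by omega)
  · intro h x hx
    rw [h5 x (by omega) (by omega)]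
    exact h x (by omega)

lemma cycleWord_of_swap (h1 : f a = a + (n + 1)) (h2 : f (a + (n + 1)) = a) :
    cycleWord f (a + (n + 1)) = [a + (n + 1), a] := by
  have hp : Function.minimalPeriod f (a + (n + 1)) = 2 := by
    apply Function.minimalPeriod_eq_prime
    · change f (f (a + (n + 1))) = a + (n + 1)
      rw [h2, h1]
    · intro h
      rw [Function.IsFixedPt, h2] at h
      omega
  simp [cycleWord, hp, List.range_succ, h2]

lemma cycleFormWord_of_swap (h1 : f a = a + (n + 1)) (h2 : f (a + (n + 1)) = a)
    (h5 : ∀ x, x ≠ a → x ≠ a + (n + 1) → f x = g x)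
    (hf : FixesOutside f a (n + 2)) (hg : FixesOutside g (a + 1) n) :
    cycleFormWord f a (n + 2) = cycleFormWord g (a + 1) n ++ [a + (n + 1), a] := by
  classical
  rw [hf.cycleFormWord_succ (n := n + 1), cycleWord_of_swap h1 h2]
  congr 1
  have hit : ∀ x ∈ List.range' (a + 1) n, ∀ k, f^[k] x = g^[k] x := by
    intro x hx k
    rw [List.mem_range'_1] at hx
    induction k with
    | zero => rfl
    | succ k ih =>
      have := hg.iterate_mem hx k
      rw [Function.iterate_succ_apply', Function.iterate_succ_apply', ih, h5 _ (by omega) (by omega)]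
  have hp : ∀ x ∈ List.range' (a + 1) n,
      Function.minimalPeriod f x = Function.minimalPeriod g x := by
    intro x hx
    rw [Function.minimalPeriod_eq_minimalPeriod_iff]
    intro k
    rw [Function.IsPeriodicPt, Function.IsPeriodicPt, Function.IsFixedPt, Function.IsFixedPt,
      hit x hx]
  have ha : ¬ ∀ k, f^[k] a ≤ a := fun h => by
    have := h 1
    rw [Function.iterate_one, h1] at this
    omega
  unfold cycleFormWord
  rw [List.range'_succ, List.filter_cons_of_neg (by simpa using ha)]
  have hfilter : (List.range' (a + 1) n).filter (fun x => decide (∀ k, f^[k] x ≤ x)) =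
      (List.range' (a + 1) n).filter (fun x => decide (∀ k, g^[k] x ≤ x)) := by
    apply List.filter_congr
    intro x hx
    simp only [hit x hx]
  rw [hfilter]
  apply List.flatMap_congr
  intro x hx
  have hx' := (List.mem_filter.1 hx).1
  simp only [cycleWord, hit x hx', hp x hx']

lemma funAvoids_iff_of_swap (h1 : f a = a + (n + 1)) (h2 : f (a + (n + 1)) = a)
    (h5 : ∀ x, x ≠ a → x ≠ a + (n + 1) → f x = g x) (hf : FixesOutside f a (n + 2)) :
    FunAvoids f a (n + 2) ↔ FunAvoids g (a + 1) n := by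
  constructor
  · rintro h i j k hi hij hjk hk ⟨h6, h7⟩
    apply h i j k (by omega) hij hjk (by omega)
    rw [h5 i (by omega) (by omega), h5 j (by omega) (by omega), h5 k (by omega) (by omega)]
    exact ⟨h6, h7⟩
  · rintro h i j k hi hij hjk hk ⟨h6, h7⟩
    have hi' : i ≠ a := by
      intro hh
      rw [hh] at h6
      have := hf.apply_mem (x := k) (by omega)
      omega
    have hk' : k ≠ a + (n + 1) := by
      intro hh
      rw [hh] at h6
      have := hf.apply_mem (x := i) (by omega)
      omega
    rw [h5 i (by omega) (by omega), h5 k (by omega) (by omega)] at h6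
    rw [h5 j (by omega) (by omega), h5 k (by omega) (by omega)] at h7
    exact h i j k (by omega) hij hjk (by omega) ⟨h6, h7⟩

lemma mem_doublyAvoiding_iff_of_swap (h1 : f a = a + (n + 1)) (h2 : f (a + (n + 1)) = a)
    (h3 : g a = a) (h4 : g (a + (n + 1)) = a + (n + 1))
    (h5 : ∀ x, x ≠ a → x ≠ a + (n + 1) → f x = g x) :
    f ∈ doublyAvoiding a (n + 2) ↔ g ∈ doublyAvoiding (a + 1) n := by
  have hfix := fixesOutside_iff_of_swap h3 h4 h5
  unfold doublyAvoiding
  rw [Set.mem_ofPred_eq, Set.mem_ofPred_eq, hfix]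
  apply and_congr_right
  intro hg
  have hf := hfix.2 hg
  rw [funAvoids_iff_of_swap h1 h2 h5 hf, cycleFormWord_of_swap h1 h2 h5 hf hg,
    listAvoids_append_pair_iff]
  all_goals
    intro x hx
    rw [hg.mem_cycleFormWord] at hx
    omega

end SwapEnds

lemma setOf_swap_ends (a n : ℕ) :
    {f ∈ doublyAvoiding a (n + 2) | f a = a + (n + 1) ∧ f (a + (n + 1)) = a} =
      (Equiv.swap a (a + (n + 1)) * ·) '' doublyAvoiding (a + 1) n := by
  ext f
  constructor
  · rintro ⟨h, h1, h2⟩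
    refine ⟨Equiv.swap a (a + (n + 1)) * f, ?_, ?_⟩
    · rw [← mem_doublyAvoiding_iff_of_swap (f := f) h1 h2]
      · exact h
      · simp [h1]
      · simp [h2]
      · intro x hx hx'
        rw [Equiv.Perm.mul_apply, Equiv.swap_apply_of_ne_of_ne]
        · rw [← h2]
          exact f.injective.ne hx'
        · rw [← h1]
          exact f.injective.ne hx
    · simp [← mul_assoc]
  · rintro ⟨g, hg, rfl⟩
    have h3 : g a = a := hg.1 _ (by omega)
    have h4 : g (a + (n + 1)) = a + (n + 1) := hg.1 _ (by omega)
    have h1 : (Equiv.swap a (a + (n + 1)) * g) a = a + (n + 1) := by simp [h3]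
    have h2 : (Equiv.swap a (a + (n + 1)) * g) (a + (n + 1)) = a := by simp [h4]
    refine ⟨?_, h1, h2⟩
    simp only
    rw [mem_doublyAvoiding_iff_of_swap h1 h2 h3 h4]
    · exact hg
    · intro x hx hx'
      rw [Equiv.Perm.mul_apply, Equiv.swap_apply_of_ne_of_ne]
      · rw [← h3]
        exact g.injective.ne hx
      · rw [← h4]
        exact g.injective.ne hx'

lemma swap_ends_of_not_cyclic {f : Equiv.Perm ℕ} {a n : ℕ} (h : f ∈ doublyAvoiding a (n + 1))
    (hm : f (a + n) ≠ a + n) {x : ℕ} (hx : a ≤ x ∧ x < a + (n + 1))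
    (hxm : x ∉ cycleWord f (a + n)) : f a = a + n ∧ f (a + n) = a := by
  obtain ⟨hs, hF, hL⟩ := h
  have hmm : a + n ∈ cycleWord f (a + n) := hs.mem_cycleWord.2 ⟨0, rfl⟩
  have hlt : ∀ x, a ≤ x ∧ x < a + (n + 1) → x ∉ cycleWord f (a + n) →
      ∀ y ∈ cycleWord f (a + n), y ≠ a + n → y < x := by
    intro x hx hxm y hy hym
    obtain ⟨R, hR⟩ := hs.exists_cycleWord_eq_cons (a + n)
    have h1 := (hs.mem_cycleFormWord x).2 hx
    have h2 := (hs.mem_cycleFormWord y).1 (by rw [hs.cycleFormWord_succ]; simp [hy])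
    rw [hs.cycleFormWord_succ, List.mem_append, or_iff_left hxm] at h1
    rw [hs.cycleFormWord_succ, hR] at hL
    have h3 : y ≤ x := by
      apply hL.lt_of_append (by omega) h1
      rw [hR, List.mem_cons] at hy
      exact hy.resolve_left hym
    have h4 : y ≠ x := by
      rintro rfl
      exact hxm hy
    omega
  have hxn : x ≠ a + n := by
    rintro rfl
    exact hxm hmm
  have hfx : f x ∉ cycleWord f (a + n) := by rwa [hs.apply_mem_cycleWord]
  have hfx' := hs.apply_mem hx
  have hfxm : f x ≠ a + n := by
    intro hh
    rw [hh] at hfx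
    exact hfx hmm
  have hfm : f (a + n) ∈ cycleWord f (a + n) := by rwa [hs.apply_mem_cycleWord]
  have hfm' := hs.apply_mem (x := a + n) (by omega)
  have hmx := hlt (f x) hfx' hfx _ hfm hm
  obtain ⟨p, hp⟩ := f.surjective (a + n)
  have hpO : p ∈ cycleWord f (a + n) := by rw [← hs.apply_mem_cycleWord, hp]; exact hmm
  have hpm : p ≠ a + n := by
    rintro rfl
    exact hm hp
  have hpb := hs.mem_of_apply_mem (x := p) (by omega)
  have hpx := hlt x hx hxm p hpO hpm
  have haO : a ∈ cycleWord f (a + n) := by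
    by_contra hc
    have := hlt a (by omega) hc p hpO hpm
    omega
  have hpa : p = a := by
    by_contra hpa
    have hfa : f a ≠ a + n := by
      rw [← hp]
      exact f.injective.ne (Ne.symm hpa)
    have := hlt (f x) hfx' hfx (f a) (by rwa [hs.apply_mem_cycleWord]) hfa
    apply hF a p x <;> omega
  subst hpa
  refine ⟨hp, ?_⟩
  by_contra hne
  obtain ⟨v, hv⟩ := f.surjective p
  have hvO : v ∈ cycleWord f (p + n) := by rw [← hs.apply_mem_cycleWord, hv]; exact haO
  have hvm : v ≠ p + n := by
    rintro rfl
    exact hne hv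
  have hvb := hs.mem_of_apply_mem (x := v) (by omega)
  have hvx := hlt x hx hxm v hvO hvm
  apply hF v x (p + n) <;> omega

lemma doublyAvoiding_one (a : ℕ) : (doublyAvoiding a 1).ncard = 1 := by
  have h := ncard_setOf_cyclic a 0
  rw [Nat.fib_one] at h
  refine Eq.trans ?_ h
  congr 1
  ext f
  refine ⟨fun hf => ⟨hf, fun z hz => ?_⟩, fun hf => hf.1⟩
  rw [hf.1.mem_cycleWord]
  exact ⟨0, by simp; omega⟩

lemma disjoint_last_fixed_cyclic (a n : ℕ) :
    Disjoint {f ∈ doublyAvoiding a (n + 2) | f (a + (n + 1)) = a + (n + 1)}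
      {f ∈ doublyAvoiding a (n + 2) |
        ∀ z, a ≤ z ∧ z < a + (n + 2) → z ∈ cycleWord f (a + (n + 1))} := by
  rw [Set.disjoint_left]
  rintro f ⟨-, h1⟩ ⟨-, h2⟩
  have := h2 a (by omega)
  rw [cycleWord_of_fixed h1] at this
  simp at this

lemma doublyAvoiding_two (a : ℕ) : (doublyAvoiding a 2).ncard = 2 := by
  have h : doublyAvoiding a 2 = {f ∈ doublyAvoiding a 2 | f (a + 1) = a + 1} ∪
      {f ∈ doublyAvoiding a 2 | ∀ z, a ≤ z ∧ z < a + 2 → z ∈ cycleWord f (a + 1)} := by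
    ext f
    refine ⟨fun hf => ?_, fun hf => hf.elim And.left And.left⟩
    by_cases hm : f (a + 1) = a + 1
    · exact .inl ⟨hf, hm⟩
    · refine .inr ⟨hf, fun z hz => ?_⟩
      have h1 := hf.1.apply_mem (x := a + 1) (by omega)
      rw [hf.1.mem_cycleWord]
      obtain h | h : z = a + 1 ∨ z = f (a + 1) := by omega
      · exact ⟨0, h.symm⟩
      · exact ⟨1, h.symm⟩
  have hfin := finite_doublyAvoiding a 2
  rw [h, Set.ncard_union_eq (disjoint_last_fixed_cyclic a 0) (hfin.subset fun f hf => hf.1)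
    (hfin.subset fun f hf => hf.1), setOf_last_fixed, ncard_setOf_cyclic, doublyAvoiding_one]
  rfl

lemma ncard_doublyAvoiding_add_three (a n : ℕ) : (doublyAvoiding a (n + 3)).ncard =
    (doublyAvoiding a (n + 2)).ncard + (doublyAvoiding (a + 1) (n + 1)).ncard +
      Nat.fib (n + 3) := by
  have h : doublyAvoiding a (n + 3) =
      {f ∈ doublyAvoiding a (n + 3) | f (a + (n + 2)) = a + (n + 2)} ∪
      {f ∈ doublyAvoiding a (n + 3) |
        ∀ z, a ≤ z ∧ z < a + (n + 3) → z ∈ cycleWord f (a + (n + 2))} ∪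
      {f ∈ doublyAvoiding a (n + 3) | f a = a + (n + 2) ∧ f (a + (n + 2)) = a} := by
    ext f
    refine ⟨fun hf => ?_, fun hf => hf.elim (fun h => h.elim And.left And.left) And.left⟩
    by_cases hm : f (a + (n + 2)) = a + (n + 2)
    · exact .inl (.inl ⟨hf, hm⟩)
    by_cases hc : ∀ z, a ≤ z ∧ z < a + (n + 3) → z ∈ cycleWord f (a + (n + 2))
    · exact .inl (.inr ⟨hf, hc⟩)
    · push Not at hc
      obtain ⟨z, hz, hzm⟩ := hc
      exact .inr ⟨hf, swap_ends_of_not_cyclic hf hm hz hzm⟩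
  have hfin := finite_doublyAvoiding a (n + 3)
  have hfin' {P : Equiv.Perm ℕ → Prop} : {f ∈ doublyAvoiding a (n + 3) | P f}.Finite :=
    hfin.subset fun f hf => hf.1
  rw [h, Set.ncard_union_eq _ (hfin'.union hfin') hfin',
    Set.ncard_union_eq (disjoint_last_fixed_cyclic a (n + 1)) hfin' hfin',
    setOf_last_fixed, ncard_setOf_cyclic, setOf_swap_ends,
    Set.ncard_image_of_injective _ (mul_right_injective _)]
  · ring
  · rw [Set.disjoint_left]
    rintro f (⟨-, h1⟩ | ⟨-, h1⟩) ⟨-, h2, h3⟩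
    · omega
    · have := h1 (a + 1) (by omega)
      rw [cycleWord_of_swap h2 h3] at this
      simp at this

/-- The convolution of the Fibonacci numbers with themselves. -/
def fibConv (n : ℕ) : ℕ := ∑ k ∈ Finset.range (n + 2), Nat.fib (n + 1 - k) * Nat.fib k

lemma fibConv_add_two (n : ℕ) :
    fibConv (n + 2) = fibConv (n + 1) + fibConv n + Nat.fib (n + 2) := by
  unfold fibConv
  rw [Finset.sum_range_succ, Finset.sum_range_succ, Finset.sum_range_succ (n := n + 2)]
  have : ∀ k ∈ Finset.range (n + 2), Nat.fib (n + 2 + 1 - k) * Nat.fib k =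
      Nat.fib (n + 1 + 1 - k) * Nat.fib k + Nat.fib (n + 1 - k) * Nat.fib k := by
    intro k hk
    rw [Finset.mem_range] at hk
    rw [← add_mul, show n + 2 + 1 - k = n + 1 - k + 2 by omega, Nat.fib_add_two,
      show n + 1 + 1 - k = n + 1 - k + 1 by omega, add_comm (Nat.fib _)]
  rw [Finset.sum_congr rfl this, Finset.sum_add_distrib]
  simp [show n + 2 + 1 - (n + 2) = 1 by omega]

lemma ncard_doublyAvoiding_succ (a n : ℕ) :
    (doublyAvoiding a (n + 1)).ncard = fibConv (n + 1) := by
  induction n using Nat.twoStepInduction generalizing a with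
  | zero => rw [doublyAvoiding_one]; decide
  | one => rw [doublyAvoiding_two]; decide
  | more n ih1 ih2 => rw [ncard_doublyAvoiding_add_three, ih1, ih2, ← fibConv_add_two]

section Bridge

variable {n : ℕ}

lemma avoids_p132_iff (π : Equiv.Perm (Fin n)) :
    Avoids π p132 ↔ ∀ i j k, i < j → j < k → ¬ (π i < π k ∧ π k < π j) := by
  unfold Avoids Contains
  constructor
  · rintro h i j k hij hjk ⟨h1, h2⟩
    refine h ⟨![i, j, k], ?_, ?_⟩
    · rw [Fin.strictMono_iff_lt_succ]
      intro x
      fin_cases x <;> simpa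
    · have h3 := h1.trans h2
      intro x y
      fin_cases x <;> fin_cases y <;>
        simp [p132, h1, h2, h3, h1.le, h2.le, h3.le]
  · rintro h ⟨f, hf, hfσ⟩
    refine h (f 0) (f 1) (f 2) (hf (by decide)) (hf (by decide)) ⟨?_, ?_⟩
    · rw [hfσ]
      simp [p132]
    · rw [hfσ]
      simp [p132]

/-- A permutation of `Fin n`, extended to `ℕ` by the identity. -/
noncomputable def natPerm (π : Equiv.Perm (Fin n)) : Equiv.Perm ℕ :=
  π.extendDomain Fin.equivSubtype

lemma natPerm_apply (π : Equiv.Perm (Fin n)) (i : Fin n) : natPerm π i = π i :=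
  Equiv.Perm.extendDomain_apply_image π Fin.equivSubtype i

lemma fixesOutside_natPerm (π : Equiv.Perm (Fin n)) : FixesOutside (natPerm π) 0 n :=
  fun x hx => Equiv.Perm.extendDomain_apply_not_subtype π Fin.equivSubtype (by omega)

lemma natPerm_injective : Function.Injective (natPerm (n := n)) := by
  intro π ρ h
  ext i
  rw [← natPerm_apply, ← natPerm_apply, h]

lemma exists_natPerm_eq {f : Equiv.Perm ℕ} (hf : FixesOutside f 0 n) :
    ∃ π : Equiv.Perm (Fin n), natPerm π = f := by
  have hlt (i : Fin n) : f i < n := by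
    have := hf.apply_mem (x := i) (by omega)
    omega
  have hinj : Function.Injective fun i : Fin n => (⟨f i, hlt i⟩ : Fin n) := by
    intro i j hij
    exact Fin.ext (f.injective (Fin.mk.inj_iff.1 hij))
  refine ⟨Equiv.ofBijective _ (Finite.injective_iff_bijective.1 hinj), ?_⟩
  ext x
  by_cases hx : x < n
  · exact natPerm_apply _ ⟨x, hx⟩
  · rw [hf x (by omega), fixesOutside_natPerm _ x (by omega)]

lemma funAvoids_natPerm_iff (π : Equiv.Perm (Fin n)) :
    FunAvoids (natPerm π) 0 n ↔ Avoids π p132 := by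
  rw [avoids_p132_iff]
  constructor
  · intro h i j k hij hjk
    have := h i j k (by omega) hij hjk (by omega)
    simpa only [natPerm_apply, Fin.val_fin_lt] using this
  · intro h i j k _ hij hjk hk
    have := h ⟨i, by omega⟩ ⟨j, by omega⟩ ⟨k, by omega⟩ hij hjk
    simpa only [Fin.lt_def, ← natPerm_apply] using this

lemma natPerm_iterate (π : Equiv.Perm (Fin n)) (k : ℕ) (i : Fin n) :
    (natPerm π)^[k] i = (π^[k] i : Fin n) := by
  have : Function.Semiconj Fin.val π (natPerm π) := fun i => (natPerm_apply π i).symm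
  exact ((this.iterate_right k) i).symm

lemma cycleWord_natPerm (π : Equiv.Perm (Fin n)) (i : Fin n) :
    cycleWord (natPerm π) i = (cycleWord π i).map Fin.val := by
  have : Function.minimalPeriod (natPerm π) i = Function.minimalPeriod π i := by
    rw [Function.minimalPeriod_eq_minimalPeriod_iff]
    intro k
    rw [Function.IsPeriodicPt, Function.IsFixedPt, natPerm_iterate, Fin.val_inj]
    rfl
  rw [cycleWord, cycleWord, this, List.map_map]
  exact List.map_congr_left fun k _ => natPerm_iterate π k i

lemma forall_iterate_natPerm_le_iff (π : Equiv.Perm (Fin n)) (i : Fin n) :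
    (∀ k, (natPerm π)^[k] i ≤ i) ↔ ∀ k < n, π^[k] i ≤ i := by
  simp only [natPerm_iterate, Fin.val_fin_le]
  refine ⟨fun h k _ => h k, fun h k => ?_⟩
  rw [← Function.iterate_mod_minimalPeriod_eq]
  apply h
  have hpos : 0 < Function.minimalPeriod π i :=
    Function.minimalPeriod_pos_of_mem_periodicPts (Function.Injective.mem_periodicPts π.injective i)
  refine (Nat.mod_lt _ hpos).trans_le ?_
  simpa using Function.minimalPeriod_le_card (f := π) (x := i)

lemma cycleFormWord_natPerm (π : Equiv.Perm (Fin n)) :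
    cycleFormWord (natPerm π) 0 n = (fundWord π).map Fin.val := by
  rw [cycleFormWord, fundWord, ← List.range_eq_range', ← List.map_coe_finRange_eq_range,
    List.filter_map, List.flatMap_map, List.map_flatMap]
  simp only [cycleWord_natPerm]
  congr 1
  apply List.filter_congr
  intro i _
  rw [Bool.eq_iff_iff]
  simp [forall_iterate_natPerm_le_iff]

lemma map_theta (π : Equiv.Perm (Fin n)) : (List.finRange n).map (theta π) = fundWord π := by
  have hfix := fixesOutside_natPerm π
  have hd := hfix.nodup_cycleFormWord
  have hm := hfix.mem_cycleFormWord
  rw [cycleFormWord_natPerm] at hd hm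
  have hd := List.Nodup.of_map _ hd
  have hperm : (fundWord π).Perm (List.finRange n) := by
    rw [List.perm_ext_iff_of_nodup hd (List.nodup_finRange n)]
    intro i
    have := (hm i).2 (by omega)
    simpa [Fin.val_inj] using this
  have hlen : (fundWord π).length = n := by simp [hperm.length_eq]
  have hinj : Function.Injective fun i : Fin n => (fundWord π)[(i : ℕ)]'(by omega) := by
    intro i j hij
    exact Fin.ext ((hd.getElem_inj_iff).1 hij)
  refine Function.invFun_eq (f := fun σ : Equiv.Perm (Fin n) => (List.finRange n).map ⇑σ)
    ⟨Equiv.ofBijective _ (Finite.injective_iff_bijective.1 hinj), ?_⟩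
  apply List.ext_getElem
  · simp [hlen]
  · simp

lemma listAvoids_natPerm_iff (π : Equiv.Perm (Fin n)) :
    ListAvoids (cycleFormWord (natPerm π) 0 n) ↔ Avoids (theta π) p132 := by
  rw [cycleFormWord_natPerm, ← map_theta, avoids_p132_iff, ListAvoids,
    List.triplewise_iff_getElem]
  constructor
  · intro h i j k hij hjk
    simpa using h i j k hij hjk (by simp)
  · intro h i j k hij hjk hk
    have hk' : k < n := by simpa using hk
    simpa using h ⟨i, by omega⟩ ⟨j, by omega⟩ ⟨k, hk'⟩ hij hjk

lemma natPerm_mem_doublyAvoiding_iff (π : Equiv.Perm (Fin n)) :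
    natPerm π ∈ doublyAvoiding 0 n ↔ Avoids π p132 ∧ Avoids (theta π) p132 := by
  rw [← funAvoids_natPerm_iff, ← listAvoids_natPerm_iff]
  exact and_iff_right (fixesOutside_natPerm π)

lemma card_avoids_theta (n : ℕ) :
    Nat.card {π : Equiv.Perm (Fin n) // Avoids π p132 ∧ Avoids (theta π) p132} =
      (doublyAvoiding 0 n).ncard := by
  have h : doublyAvoiding 0 n =
      natPerm '' {π : Equiv.Perm (Fin n) | Avoids π p132 ∧ Avoids (theta π) p132} := by
    ext f
    constructor
    · intro hf
      obtain ⟨π, rfl⟩ := exists_natPerm_eq hf.1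
      exact ⟨π, (natPerm_mem_doublyAvoiding_iff π).1 hf, rfl⟩
    · rintro ⟨π, hπ, rfl⟩
      exact (natPerm_mem_doublyAvoiding_iff π).2 hπ
  rw [h, Set.ncard_image_of_injective _ natPerm_injective]
  rfl

end Bridge

/-- for `n ≥ 1`, `t_n(132) = ∑_{k=0}^{n+1} F_{n+1-k} F_k`. -/
theorem t_n_132 (n : ℕ) (hn : 1 ≤ n) :
    Nat.card {π : Equiv.Perm (Fin n) // Avoids π p132 ∧ Avoids (theta π) p132} =
      ∑ k ∈ Finset.range (n + 2), Nat.fib (n + 1 - k) * Nat.fib k := by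
  obtain ⟨m, rfl⟩ := Nat.exists_eq_add_of_le' hn
  rw [card_avoids_theta, ncard_doublyAvoiding_succ]
  rfl
end

section
/- For all n ≥ 1, the number of cyclic permutations π ∈ S_n such that both π and θ(π) avoid the pattern 132 is equal to F_n, the n-th Fibonacci number. -/
/-- The word `t` avoids `132`. -/
def WordAvoids (t : List ℕ) : Prop :=
  t.Triplewise fun a b c => ¬ (a < c ∧ c < b)

/-- The pairs `(x, π x)` for the cyclic permutation `π` with cycle `(m, t₀, t₁, …)`. -/
def cycleArcs (m : ℕ) (t : List ℕ) : List (ℕ × ℕ) :=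
  (m :: t).zip (t ++ [m])

/-- The partial permutation with graph `P` avoids `132`. -/
def ArcsAvoid (P : List (ℕ × ℕ)) : Prop :=
  ∀ p ∈ P, ∀ q ∈ P, ∀ r ∈ P, p.1 < q.1 → q.1 < r.1 → p.2 < r.2 → r.2 < q.2 → False

/-- The word `t` is an arrangement of `0, …, m - 1` such that both the word `m t` and the
permutation with the single cycle `(m t)` avoid `132`. -/
structure IsGoodTail (m : ℕ) (t : List ℕ) : Prop where
  perm : t.Perm (List.range m)
  word : WordAvoids t
  arcs : ArcsAvoid (cycleArcs m t)

theorem IsGoodTail.mem_iff {m : ℕ} {t : List ℕ} (h : IsGoodTail m t) {x : ℕ} :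
    x ∈ t ↔ x < m := by
  rw [h.perm.mem_iff, List.mem_range]

theorem IsGoodTail.nodup {m : ℕ} {t : List ℕ} (h : IsGoodTail m t) : t.Nodup :=
  h.perm.nodup_iff.2 List.nodup_range

theorem wordAvoids_range (m : ℕ) : WordAvoids (List.range m) := by
  rw [WordAvoids, List.triplewise_iff_getElem]
  intro i j k hij hjk hk
  simp only [List.getElem_range]
  omega

theorem mem_cycleArcs {m : ℕ} {t : List ℕ} {p : ℕ × ℕ} :
    p ∈ cycleArcs m t ↔
      ∃ i : ℕ, (m :: t)[i]? = some p.1 ∧ (t ++ [m])[i]? = some p.2 := by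
  simp only [cycleArcs, List.mem_iff_getElem?, List.getElem?_zip_eq_some]

theorem mem_cycleArcs_of_eq {m : ℕ} {t A B : List ℕ} {x y : ℕ}
    (h : m :: (t ++ [m]) = A ++ x :: y :: B) : (x, y) ∈ cycleArcs m t := by
  rw [mem_cycleArcs]
  refine ⟨A.length, ?_, ?_⟩
  · have h1 : (m :: (t ++ [m]))[A.length]? = some x := by simp [h]
    have h2 := congrArg List.length h
    simp only [List.length_cons, List.length_append, List.length_nil] at h2
    rw [← List.cons_append, List.getElem?_append_left (by simp; omega)] at h1
    exact h1
  · have h1 : (m :: (t ++ [m]))[A.length + 1]? = some y := by simp [h]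
    simpa using h1

theorem isGoodTail_range (m : ℕ) : IsGoodTail m (List.range m) := by
  refine ⟨.refl _, wordAvoids_range m, ?_⟩
  have key : ∀ p ∈ cycleArcs m (List.range m), (p.1 = m ∧ p.2 = 0) ∨ p.2 = p.1 + 1 := by
    intro p hp
    obtain ⟨i, h1, h2⟩ := mem_cycleArcs.1 hp
    rw [← List.range_succ] at h2
    simp only [List.getElem?_eq_some_iff, List.getElem_range, exists_prop] at h2
    rcases i with _ | i
    · simp at h1; omega
    · simp only [List.getElem?_cons_succ, List.getElem?_eq_some_iff, List.getElem_range,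
        exists_prop] at h1
      omega
  intro p hp q hq r hr
  have := key p hp
  have := key q hq
  have := key r hr
  omega

theorem le_of_mem_cycleArcs {m : ℕ} {t : List ℕ} (ht : ∀ x ∈ t, x < m) {p : ℕ × ℕ}
    (hp : p ∈ cycleArcs m t) : p.1 ≤ m ∧ p.2 ≤ m := by
  have := List.of_mem_zip (a := p.1) (b := p.2) hp
  simp only [List.mem_cons, List.mem_append] at this
  have h1 := ht p.1
  have h2 := ht p.2
  grind

theorem isGoodTail_cons_iff (m : ℕ) (s : List ℕ) :
    IsGoodTail (m + 1) (m :: (s ++ [0])) ↔ IsGoodTail m (s ++ [0]) := by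
  have hperm : (m :: (s ++ [0])).Perm (List.range (m + 1)) ↔
      (s ++ [0]).Perm (List.range m) := by
    rw [List.range_succ, List.perm_comm, List.perm_append_comm.congr_left]
    simp [List.perm_comm]
  suffices H : (s ++ [0]).Perm (List.range m) →
      (IsGoodTail (m + 1) (m :: (s ++ [0])) ↔ IsGoodTail m (s ++ [0])) from
    ⟨fun h => (H (hperm.1 h.perm)).1 h, fun h => (H h.perm).2 h⟩
  intro hp
  have hlt : ∀ x ∈ s ++ [0], x < m := fun x hx => by simpa using hp.mem_iff.1 hx
  have hword : WordAvoids (m :: (s ++ [0])) ↔ WordAvoids (s ++ [0]) := by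
    rw [WordAvoids, List.triplewise_cons, WordAvoids, and_iff_right]
    refine List.pairwise_of_forall_mem_list ?_
    intro a _ b hb
    have := hlt b hb
    omega
  have e1 : cycleArcs (m + 1) (m :: (s ++ [0])) =
      (m + 1, m) :: ((m :: s).zip (s ++ [0]) ++ [(0, m + 1)]) := by
    rw [cycleArcs, List.cons_append, List.zip_cons_cons, ← List.cons_append,
      List.zip_append (by simp)]
    rfl
  have e2 : cycleArcs m (s ++ [0]) = (m :: s).zip (s ++ [0]) ++ [(0, m)] := by
    rw [cycleArcs, ← List.cons_append, List.zip_append (by simp)]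
    rfl
  have hb : ∀ p ∈ (m :: s).zip (s ++ [0]), p.1 ≤ m ∧ p.2 < m := by
    intro p hp
    have := List.of_mem_zip (a := p.1) (b := p.2) hp
    have h1 := hlt p.1
    have h2 := hlt p.2
    grind
  have harcs : ArcsAvoid (cycleArcs (m + 1) (m :: (s ++ [0]))) ↔
      ArcsAvoid (cycleArcs m (s ++ [0])) := by
    rw [e1, e2]
    generalize (m :: s).zip (s ++ [0]) = P at hb
    simp only [ArcsAvoid, List.mem_cons, List.mem_append, List.not_mem_nil, or_false]
    have hm : 0 < m := hlt 0 (by simp)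
    constructor
    · intro h p hp q hq r hr h1 h2 h3 h4
      have hP : p ∈ P ∧ q ∈ P ∧ r ∈ P := by
        grind
      exact h p (.inr (.inl hP.1)) q (.inr (.inl hP.2.1)) r (.inr (.inl hP.2.2)) h1 h2 h3 h4
    · intro h p hp q hq r hr h1 h2 h3 h4
      have hP : p ∈ P ∧ q ∈ P ∧ r ∈ P := by
        grind
      exact h p (.inl hP.1) q (.inl hP.2.1) r (.inl hP.2.2) h1 h2 h3 h4
  exact ⟨fun h => ⟨hp, hword.1 h.word, harcs.1 h.arcs⟩,
    fun h => ⟨hperm.2 hp, hword.2 h.word, harcs.2 h.arcs⟩⟩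

theorem isGoodTail_map_succ_append_iff (m : ℕ) (w : List ℕ) :
    IsGoodTail (m + 2) (w.map Nat.succ ++ [m + 1, 0]) ↔ IsGoodTail m w := by
  have hperm : (w.map Nat.succ ++ [m + 1, 0]).Perm (List.range (m + 2)) ↔
      w.Perm (List.range m) := by
    have : (List.range (m + 2)).Perm ((List.range m).map Nat.succ ++ [m + 1, 0]) := by
      rw [List.range_succ_eq_map, List.range_succ, List.map_append, List.map_singleton,
        ← List.singleton_append]
      refine List.perm_append_comm.trans ?_
      simp
    rw [List.perm_comm, this.congr_left, List.perm_append_right_iff,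
      List.map_perm_map_iff Nat.succ_injective, List.perm_comm]
  suffices H : w.Perm (List.range m) →
      (IsGoodTail (m + 2) (w.map Nat.succ ++ [m + 1, 0]) ↔ IsGoodTail m w) from
    ⟨fun h => (H (hperm.1 h.perm)).1 h, fun h => (H h.perm).2 h⟩
  intro hp
  have hlt : ∀ x ∈ w, x < m := fun x hx => by simpa using hp.mem_iff.1 hx
  have hword : WordAvoids (w.map Nat.succ ++ [m + 1, 0]) ↔ WordAvoids w := by
    simp only [WordAvoids, List.triplewise_append, List.triplewise_map, Nat.succ_eq_add_one,
      add_lt_add_iff_right]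
    refine and_iff_left ⟨by simp, by simp, ?_⟩
    intro a ha
    refine List.pairwise_of_forall_mem_list ?_
    intro b _ c hc
    simp only [List.mem_map] at hc
    obtain ⟨x, hx, rfl⟩ := hc
    have := hlt x hx
    grind
  let f : ℕ → ℕ := fun x => if x = m then m + 2 else x + 1
  have e1 : cycleArcs (m + 2) (w.map Nat.succ ++ [m + 1, 0]) =
      (cycleArcs m w).map (Prod.map f Nat.succ) ++ [(m + 1, 0), (0, m + 2)] := by
    have h1 : (m + 2) :: (w.map Nat.succ ++ [m + 1, 0]) = (m :: w).map f ++ [m + 1, 0] := by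
      have : w.map Nat.succ = w.map f := by
        refine List.map_congr_left fun x hx => ?_
        have := hlt x hx
        simp only [f]
        rw [if_neg (by omega)]
      simp [this, f]
    have h2 : w.map Nat.succ ++ [m + 1, 0] ++ [m + 2] =
        (w ++ [m]).map Nat.succ ++ [0, m + 2] := by simp
    rw [cycleArcs, h1, h2, List.zip_append (by simp), List.zip_map]
    rfl
  have hb := fun p => le_of_mem_cycleArcs (p := p) hlt
  have harcs : ArcsAvoid (cycleArcs (m + 2) (w.map Nat.succ ++ [m + 1, 0])) ↔
      ArcsAvoid (cycleArcs m w) := by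
    rw [e1]
    generalize cycleArcs m w = P at hb
    have hf : ∀ x y, x ≤ m → y ≤ m → (f x < f y ↔ x < y) := by
      intro x y hx hy
      simp only [f]
      split_ifs <;> omega
    constructor
    · intro h p hp q hq r hr h1 h2 h3 h4
      have hP : ∀ z ∈ P, Prod.map f Nat.succ z ∈
          P.map (Prod.map f Nat.succ) ++ [(m + 1, 0), (0, m + 2)] := fun z hz =>
        List.mem_append_left _ (List.mem_map_of_mem hz)
      exact h _ (hP p hp) _ (hP q hq) _ (hP r hr)
        ((hf _ _ (hb p hp).1 (hb q hq).1).2 h1) ((hf _ _ (hb q hq).1 (hb r hr).1).2 h2)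
        (Nat.succ_lt_succ h3) (Nat.succ_lt_succ h4)
    · have hc : ∀ z ∈ P.map (Prod.map f Nat.succ) ++ [(m + 1, 0), (0, m + 2)],
          (∃ y ∈ P, Prod.map f Nat.succ y = z) ∨ z = (m + 1, 0) ∨ z = (0, m + 2) := by
        simp
      have hfle : ∀ x ≤ m, f x ≤ m + 2 := by
        intro x hx
        simp only [f]
        split_ifs <;> omega
      intro h p hp q hq r hr h1 h2 h3 h4
      obtain ⟨p, hp', rfl⟩ | rfl | rfl := hc p hp <;>
      obtain ⟨q, hq', rfl⟩ | rfl | rfl := hc q hq <;>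
      obtain ⟨r, hr', rfl⟩ | rfl | rfl := hc r hr <;>
      simp only [Prod.map_fst, Prod.map_snd] at h1 h2 h3 h4 <;> try omega
      · exact h p hp' q hq' r hr' ((hf _ _ (hb p hp').1 (hb q hq').1).1 h1)
          ((hf _ _ (hb q hq').1 (hb r hr').1).1 h2) (by omega) (by omega)
      · have := hfle _ (hb r hr').1
        omega
      · have := hb r hr'
        omega
  exact ⟨fun h => ⟨hp, hword.1 h.word, harcs.1 h.arcs⟩,
    fun h => ⟨hperm.2 hp, hword.2 h.word, harcs.2 h.arcs⟩⟩

theorem IsGoodTail.eq_range_or_getLast {m : ℕ} {t : List ℕ} (h : IsGoodTail (m + 1) t) :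
    t = List.range (m + 1) ∨ ∃ s, t = s ++ [0] := by
  obtain ⟨X, Y, rfl⟩ := List.append_of_mem (h.mem_iff.2 (Nat.succ_pos m))
  rcases List.eq_nil_or_concat' Y with rfl | ⟨Z, p, rfl⟩
  · exact .inr ⟨X, rfl⟩
  left
  obtain ⟨hw1, hw2, hw3, hw4⟩ := List.triplewise_append.1 h.word
  have hnd := h.nodup
  have hsorted : (0 :: (Z ++ [p])).Pairwise (· ≤ ·) := by
    have hpos : ∀ b ∈ Z ++ [p], 0 < b := by
      intro b hb
      have := (List.nodup_cons.1 (List.nodup_append.1 hnd).2.1).1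
      exact Nat.pos_of_ne_zero fun h0 => this (h0 ▸ hb)
    refine List.pairwise_cons.2 ⟨fun _ _ => Nat.zero_le _, ?_⟩
    refine (List.triplewise_cons.1 hw2).1.imp_of_mem ?_
    intro a b ha hb hab
    have := hpos b hb
    omega
  rcases List.eq_nil_or_concat' X with rfl | ⟨U, u, rfl⟩
  · exact h.perm.eq_of_pairwise' hsorted List.pairwise_le_range
  exfalso
  have hpm : p < m + 1 := h.mem_iff.1 (by simp)
  obtain ⟨x, V, hx⟩ := List.exists_cons_of_ne_nil (List.append_ne_nil_of_right_ne_nil U (by simp :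
    [u] ≠ []))
  obtain ⟨a, W, ha⟩ := List.exists_cons_of_ne_nil (List.append_ne_nil_of_right_ne_nil Z (by simp :
    [p] ≠ []))
  have arc_u : (u, 0) ∈ cycleArcs (m + 1) (U ++ [u] ++ 0 :: (Z ++ [p])) :=
    mem_cycleArcs_of_eq (A := (m + 1) :: U) (B := Z ++ [p] ++ [m + 1]) (by simp)
  have arc_p : (p, m + 1) ∈ cycleArcs (m + 1) (U ++ [u] ++ 0 :: (Z ++ [p])) :=
    mem_cycleArcs_of_eq (A := (m + 1) :: (U ++ [u] ++ 0 :: Z)) (B := []) (by simp)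
  have arc_m : (m + 1, x) ∈ cycleArcs (m + 1) (U ++ [u] ++ 0 :: (Z ++ [p])) :=
    mem_cycleArcs_of_eq (A := []) (B := V ++ 0 :: (Z ++ [p]) ++ [m + 1]) (by simp [hx])
  have arc_zero : (0, a) ∈ cycleArcs (m + 1) (U ++ [u] ++ 0 :: (Z ++ [p])) :=
    mem_cycleArcs_of_eq (A := (m + 1) :: (U ++ [u])) (B := W ++ [m + 1]) (by simp [ha])
  have hxm : x < m + 1 := h.mem_iff.1 (by simp [hx])
  have hdisj := (List.nodup_append.1 hnd).2.2
  have hxmem : x ∈ U ++ [u] := by simp [hx]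
  have hx0 : x ≠ 0 := hdisj x hxmem 0 (by simp)
  have hxp : x ≠ p := hdisj x hxmem p (by simp)
  have hup : p < u := by
    have hne : u ≠ p := hdisj u (by simp) p (by simp)
    by_contra hlt
    exact h.arcs _ arc_u _ arc_p _ arc_m (by simp only; omega) hpm (by simp only; omega) hxm
  have hpx : p < x := by
    rcases List.mem_append.1 hxmem with hxU | hxu
    · have := (List.pairwise_append.1 (hw4 p (by simp))).2.2 x hxU u (by simp)
      omega
    · rw [List.mem_singleton.1 hxu]
      exact hup
  have hap : a ≤ p := by
    have hs := (List.pairwise_cons.1 hsorted).2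
    have hmem : a ∈ Z ++ [p] := by simp [ha]
    rcases List.mem_append.1 hmem with haZ | hap
    · exact (List.pairwise_append.1 hs).2.2 a haZ p (by simp)
    · exact (List.mem_singleton.1 hap).le
  have hp0 : 0 < p := by
    have := (List.nodup_cons.1 (List.nodup_append.1 hnd).2.1).1
    exact Nat.pos_of_ne_zero fun h0 => this (by simp [h0])
  exact h.arcs _ arc_zero _ arc_p _ arc_m hp0 hpm (by simp only; omega) hxm

theorem IsGoodTail.succ_largest_head_or_last {m : ℕ} {s : List ℕ}
    (h : IsGoodTail (m + 2) (s ++ [0])) :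
    (∃ s', s = (m + 1) :: s') ∨ ∃ s', s = s' ++ [m + 1] := by
  have hmem : m + 1 ∈ s := by
    have := h.mem_iff.2 (Nat.lt_succ_self (m + 1))
    simpa using this
  obtain ⟨A, B, rfl⟩ := List.append_of_mem hmem
  rcases List.eq_nil_or_concat' A with rfl | ⟨A', i, rfl⟩
  · exact .inl ⟨B, rfl⟩
  rcases B with _ | ⟨y, B⟩
  · exact .inr ⟨A' ++ [i], rfl⟩
  exfalso
  obtain ⟨x, V, hx⟩ := List.exists_cons_of_ne_nil (List.append_ne_nil_of_right_ne_nil A' (by simp :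
    [i] ≠ []))
  have hnd := h.nodup
  rw [List.append_assoc] at hnd
  have hdisj := (List.nodup_append.1 hnd).2.2
  have hgt : ∀ a ∈ A' ++ [i], ∀ z ∈ y :: B ++ [0], z < a := by
    intro a ha z hz
    have hword := h.word
    rw [WordAvoids, List.append_assoc, List.triplewise_append] at hword
    have h1 := (List.pairwise_cons.1 (hword.2.2.1 a ha)).1 z hz
    have h2 : a ≠ z := hdisj a ha z (List.mem_cons_of_mem _ hz)
    have h3 : z < m + 2 := by
      rw [← h.mem_iff]
      simp only [List.mem_append, List.mem_cons] at hz ⊢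
      tauto
    have h4 : z ≠ m + 1 := by
      rintro rfl
      exact (List.nodup_cons.1 (List.nodup_append.1 hnd).2.1).1 hz
    omega
  have hi : 0 < i := hgt i (by simp) 0 (by simp)
  have hy : y ≠ 0 := by
    rintro rfl
    have := (List.nodup_cons.1 (List.nodup_append.1 hnd).2.1).2
    simp at this
  have hone : 1 ∈ y :: B := by
    have h1 : 1 ∈ A' ++ [i] ++ (m + 1) :: (y :: B) ++ [0] := h.mem_iff.2 (by omega)
    have h2 : 1 ∉ A' ++ [i] := fun hmem => by
      have := hgt 1 hmem y (by simp)
      omega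
    have h3 : 1 ≠ m + 1 := by
      have h4 : y < m + 2 := h.mem_iff.1 (by simp)
      have h5 : y ≠ m + 1 := by
        rintro rfl
        exact (List.nodup_cons.1 (List.nodup_append.1 hnd).2.1).1 (by simp)
      omega
    simp only [List.mem_append, List.mem_cons, List.not_mem_nil, or_false] at h1 h2 ⊢
    tauto
  obtain ⟨C, D, hCD⟩ := List.append_of_mem hone
  obtain ⟨s, E, hs⟩ := List.exists_cons_of_ne_nil (List.append_ne_nil_of_right_ne_nil D (by simp :
    [0] ≠ []))
  have arc_one : (1, s) ∈ cycleArcs (m + 2) (A' ++ [i] ++ (m + 1) :: (y :: B) ++ [0]) :=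
    mem_cycleArcs_of_eq (A := (m + 2) :: (A' ++ [i] ++ (m + 1) :: C)) (B := E ++ [m + 2]) (by
      have : D ++ 0 :: [m + 2] = s :: (E ++ [m + 2]) := by
        rw [← List.singleton_append, ← List.append_assoc, hs, List.cons_append]
      simp [hCD, this])
  have arc_i : (i, m + 1) ∈ cycleArcs (m + 2) (A' ++ [i] ++ (m + 1) :: (y :: B) ++ [0]) :=
    mem_cycleArcs_of_eq (A := (m + 2) :: A') (B := y :: B ++ [0] ++ [m + 2]) (by simp)
  have arc_m : (m + 2, x) ∈ cycleArcs (m + 2) (A' ++ [i] ++ (m + 1) :: (y :: B) ++ [0]) :=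
    mem_cycleArcs_of_eq (A := []) (B := V ++ (m + 1) :: (y :: B) ++ [0] ++ [m + 2]) (by simp [hx])
  have hsmem : s ∈ y :: B ++ [0] := by
    rw [hCD, List.append_assoc, List.cons_append, hs]
    simp
  have hxmem : x ∈ A' ++ [i] := by simp [hx]
  have hxm : x < m + 1 := by
    have h1 : x < m + 2 := h.mem_iff.1 (by simp [hx])
    have h2 : x ≠ m + 1 := hdisj x hxmem (m + 1) (by simp)
    omega
  have him : i < m + 2 := h.mem_iff.1 (by simp)
  exact h.arcs _ arc_one _ arc_i _ arc_m
    (hgt i (by simp) 1 (List.mem_append_left _ hone)) him (hgt x hxmem s hsmem) hxm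

/-- The tails counted by `IsGoodTail` that end in `0`. -/
def goodTailsToZero : ℕ → Finset (List ℕ)
  | 0 => ∅
  | 1 => {[0]}
  | m + 2 => (goodTailsToZero (m + 1)).image (List.cons (m + 1)) ∪
      (insert (List.range m) (goodTailsToZero m)).image fun w => w.map Nat.succ ++ [m + 1, 0]

/-- The finite set of all `t` with `IsGoodTail m t`. -/
def goodTails (m : ℕ) : Finset (List ℕ) :=
  insert (List.range m) (goodTailsToZero m)

theorem goodTailsToZero_add_two (m : ℕ) :
    goodTailsToZero (m + 2) = (goodTailsToZero (m + 1)).image (List.cons (m + 1)) ∪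
      (goodTails m).image fun w => w.map Nat.succ ++ [m + 1, 0] := by
  rw [goodTailsToZero, goodTails]

theorem isGoodTail_iff_mem_goodTails_of {m : ℕ}
    (hm : ∀ t, t ∈ goodTailsToZero m ↔ IsGoodTail m t ∧ ∃ s, t = s ++ [0]) (t : List ℕ) :
    t ∈ goodTails m ↔ IsGoodTail m t := by
  rw [goodTails, Finset.mem_insert, hm]
  constructor
  · rintro (rfl | h)
    · exact isGoodTail_range m
    · exact h.1
  · intro h
    rcases m with _ | m
    · exact .inl (by simpa using h.perm)
    · exact h.eq_range_or_getLast.imp_right fun hs => ⟨h, hs⟩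

theorem mem_goodTailsToZero_iff (m : ℕ) (t : List ℕ) :
    t ∈ goodTailsToZero m ↔ IsGoodTail m t ∧ ∃ s, t = s ++ [0] := by
  induction m using Nat.twoStepInduction generalizing t with
  | zero =>
    simp only [goodTailsToZero, Finset.notMem_empty, false_iff]
    rintro ⟨h, s, rfl⟩
    simpa using h.perm
  | one =>
    simp only [goodTailsToZero, Finset.mem_singleton]
    constructor
    · rintro rfl
      exact ⟨isGoodTail_range 1, [], rfl⟩
    · rintro ⟨h, -⟩
      simpa using h.perm
  | more m ih0 ih1 =>
    rw [goodTailsToZero_add_two]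
    simp only [Finset.mem_union, Finset.mem_image, ih1, isGoodTail_iff_mem_goodTails_of ih0]
    constructor
    · rintro (⟨_, ⟨h, s, rfl⟩, rfl⟩ | ⟨w, h, rfl⟩)
      · exact ⟨(isGoodTail_cons_iff _ _).2 h, (m + 1) :: s, rfl⟩
      · exact ⟨(isGoodTail_map_succ_append_iff _ _).2 h, w.map Nat.succ ++ [m + 1], by simp⟩
    · rintro ⟨h, s, rfl⟩
      rcases h.succ_largest_head_or_last with ⟨s, rfl⟩ | ⟨s, rfl⟩
      · exact .inl ⟨s ++ [0], ⟨(isGoodTail_cons_iff _ _).1 h, s, rfl⟩, rfl⟩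
      · have hpos : ∀ x ∈ s, x ≠ 0 := by
          have := (List.nodup_append.1 h.nodup).2.2
          exact fun x hx => this x (List.mem_append_left _ hx) 0 (by simp)
        have hs : s = (s.map Nat.pred).map Nat.succ := by
          rw [List.map_map]
          refine (List.map_id s).symm.trans (List.map_congr_left fun x hx => ?_)
          exact (Nat.succ_pred (hpos x hx)).symm
        refine .inr ⟨s.map Nat.pred, ?_, by rw [← hs]; simp⟩
        rw [← isGoodTail_map_succ_append_iff, ← hs]
        simpa using h

theorem mem_goodTails_iff {m : ℕ} {t : List ℕ} : t ∈ goodTails m ↔ IsGoodTail m t :=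
  isGoodTail_iff_mem_goodTails_of (mem_goodTailsToZero_iff m) t

theorem card_goodTails_add_two (m : ℕ) :
    (goodTails (m + 2)).card = (goodTailsToZero (m + 2)).card + 1 := by
  rw [goodTails, Finset.card_insert_of_notMem]
  rw [mem_goodTailsToZero_iff]
  rintro ⟨-, s, hs⟩
  rw [List.range_succ] at hs
  simpa using List.append_inj_right' hs rfl

theorem card_goodTailsToZero_add_three (m : ℕ) :
    (goodTailsToZero (m + 3)).card = (goodTailsToZero (m + 2)).card + (goodTails (m + 1)).card := by
  rw [goodTailsToZero_add_two, Finset.card_union_of_disjoint,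
    Finset.card_image_of_injective _ List.cons_injective, Finset.card_image_of_injective]
  · intro v w hvw
    exact List.map_injective_iff.2 Nat.succ_injective (List.append_inj_left' hvw rfl)
  · rw [Finset.disjoint_left]
    simp only [Finset.mem_image, mem_goodTails_iff, not_exists, not_and]
    rintro _ ⟨t, -, rfl⟩ w hw heq
    rcases w with _ | ⟨x, w⟩
    · simpa using hw.perm.length_eq
    · have hx : x < m + 1 := hw.mem_iff.1 (by simp)
      simp only [List.map_cons, List.cons_append, List.cons.injEq] at heq
      omega

theorem card_goodTails (m : ℕ) : (goodTails m).card = Nat.fib (m + 1) := by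
  induction m using Nat.strong_induction_on with
  | _ m ih =>
    match m with
    | 0 => decide
    | 1 => decide
    | 2 => decide
    | m + 3 =>
      have h1 : _ = Nat.fib (m + 3) := ih (m + 2) (by omega)
      have h2 : _ = Nat.fib (m + 2) := ih (m + 1) (by omega)
      have h3 := card_goodTails_add_two m
      have h4 : Nat.fib (m + 4) = Nat.fib (m + 2) + Nat.fib (m + 3) := Nat.fib_add_two
      rw [card_goodTails_add_two, card_goodTailsToZero_add_three, h4]
      omega

theorem contains_p132_iff {n : ℕ} (π : Equiv.Perm (Fin n)) :
    Contains p132 π ↔ ∃ i j k, i < j ∧ j < k ∧ π i < π k ∧ π k < π j := by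
  have h0 : p132 0 = 0 := rfl
  have h1 : p132 1 = 2 := rfl
  have h2 : p132 2 = 1 := rfl
  constructor
  · rintro ⟨f, hf, h⟩
    refine ⟨f 0, f 1, f 2, hf (by decide), hf (by decide), (h 0 2).2 ?_, (h 2 1).2 ?_⟩
    · rw [h0, h2]; decide
    · rw [h1, h2]; decide
  · rintro ⟨i, j, k, hij, hjk, h3, h4⟩
    refine ⟨![i, j, k], ?_, ?_⟩
    · intro a b hab
      fin_cases a <;> fin_cases b <;> simp_all [hij.trans hjk]
    · intro a b
      fin_cases a <;> fin_cases b <;>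
        simp [h0, h1, h2, h3, h4, h3.trans h4, h3.le, h4.le, (h3.trans h4).le]

/-- The word `π m, π² m, …, πᵐ m` of the orbit of the largest element `m`, without `m` itself. -/
def orbitTail {m : ℕ} (π : Equiv.Perm (Fin (m + 1))) : List ℕ :=
  (List.range m).map fun k => (((⇑π)^[k + 1] (Fin.last m) : Fin (m + 1)) : ℕ)

section Cyclic

variable {m : ℕ} {π : Equiv.Perm (Fin (m + 1))}

theorem IsCyclicPerm.minimalPeriod_eq (h : IsCyclicPerm π) (x : Fin (m + 1)) :
    Function.minimalPeriod (⇑π) x = m + 1 := by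
  have hpos : 0 < Function.minimalPeriod (⇑π) x :=
    Function.minimalPeriod_pos_of_mem_periodicPts (π.injective.mem_periodicPts x)
  have himage : (Finset.range (Function.minimalPeriod (⇑π) x)).image (fun k => (⇑π)^[k] x) =
      Finset.univ := by
    refine Finset.eq_univ_of_forall fun y => ?_
    obtain ⟨k, rfl⟩ := h x y
    exact Finset.mem_image.2 ⟨k % Function.minimalPeriod (⇑π) x,
      Finset.mem_range.2 (Nat.mod_lt _ hpos), Function.iterate_mod_minimalPeriod_eq⟩
  have hcard := congrArg Finset.card himage
  rw [Finset.card_image_of_injOn, Finset.card_range, Finset.card_univ, Fintype.card_fin] at hcard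
  · exact hcard
  · intro a ha b hb
    exact fun hab => Function.iterate_injOn_Iio_minimalPeriod (by simpa using ha)
      (by simpa using hb) hab

theorem IsCyclicPerm.exists_iterate_eq (h : IsCyclicPerm π) (x y : Fin (m + 1)) :
    ∃ k < m + 1, (⇑π)^[k] x = y := by
  obtain ⟨k, rfl⟩ := h x y
  refine ⟨k % (m + 1), Nat.mod_lt _ m.succ_pos, ?_⟩
  have := Function.iterate_mod_minimalPeriod_eq (f := ⇑π) (x := x) (n := k)
  rwa [h.minimalPeriod_eq] at this

theorem IsCyclicPerm.iterate_last_bijective (h : IsCyclicPerm π) :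
    Function.Bijective fun k : Fin (m + 1) => (⇑π)^[(k : ℕ)] (Fin.last m) := by
  refine Finite.surjective_iff_bijective.1 fun y => ?_
  obtain ⟨k, hk, rfl⟩ := h.exists_iterate_eq (Fin.last m) y
  exact ⟨⟨k, hk⟩, rfl⟩

theorem IsCyclicPerm.fundWord_eq (h : IsCyclicPerm π) :
    fundWord π = (List.range (m + 1)).map fun k => (⇑π)^[k] (Fin.last m) := by
  have hfilter : ((List.finRange (m + 1)).filter fun x =>
      (List.range (m + 1)).all fun k => decide ((⇑π)^[k] x ≤ x)) = [Fin.last m] := by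
    rw [List.finRange_succ_last, List.filter_append]
    have h1 : ((List.finRange m).map Fin.castSucc).filter (fun x =>
        (List.range (m + 1)).all fun k => decide ((⇑π)^[k] x ≤ x)) = [] := by
      rw [List.filter_eq_nil_iff]
      intro x hx hall
      obtain ⟨y, -, rfl⟩ := List.mem_map.1 hx
      obtain ⟨k, hk, hkx⟩ := h.exists_iterate_eq y.castSucc (Fin.last m)
      have := List.all_eq_true.1 hall k (List.mem_range.2 hk)
      rw [hkx, decide_eq_true_eq] at this
      exact (Fin.castSucc_lt_last y).not_ge this
    rw [h1]
    simp [Fin.le_last]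
  rw [fundWord, hfilter, List.flatMap_singleton, h.minimalPeriod_eq]

theorem IsCyclicPerm.theta_apply (h : IsCyclicPerm π) (k : Fin (m + 1)) :
    theta π k = (⇑π)^[(k : ℕ)] (Fin.last m) := by
  have hinj : Function.Injective
      fun σ : Equiv.Perm (Fin (m + 1)) => (List.finRange (m + 1)).map ⇑σ := by
    intro σ τ hst
    ext1 x
    exact List.map_inj_left.1 hst x (List.mem_finRange x)
  have hword : fundWord π =
      (List.finRange (m + 1)).map ⇑(Equiv.ofBijective _ h.iterate_last_bijective) := by
    rw [h.fundWord_eq, ← List.map_coe_finRange_eq_range, List.map_map]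
    rfl
  rw [theta, permOfWord, hword]
  exact congrArg (fun σ : Equiv.Perm (Fin (m + 1)) => σ k)
    (Function.leftInverse_invFun hinj (Equiv.ofBijective _ h.iterate_last_bijective))

theorem cons_orbitTail (π : Equiv.Perm (Fin (m + 1))) :
    m :: orbitTail π =
      (List.range (m + 1)).map fun k => (((⇑π)^[k] (Fin.last m) : Fin (m + 1)) : ℕ) := by
  rw [List.range_succ_eq_map, List.map_cons, List.map_map]
  rfl

theorem IsCyclicPerm.orbitTail_append (h : IsCyclicPerm π) :
    orbitTail π ++ [m] =
      (List.range (m + 1)).map fun k => (((⇑π)^[k + 1] (Fin.last m) : Fin (m + 1)) : ℕ) := by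
  have hper : (⇑π)^[m + 1] (Fin.last m) = Fin.last m := by
    have := Function.iterate_minimalPeriod (f := ⇑π) (x := Fin.last m)
    rwa [h.minimalPeriod_eq] at this
  rw [List.range_succ, List.map_append, List.map_singleton, hper]
  rfl

theorem IsCyclicPerm.mem_cycleArcs_iff (h : IsCyclicPerm π) (p : ℕ × ℕ) :
    p ∈ cycleArcs m (orbitTail π) ↔ ∃ x : Fin (m + 1), p = ((x : ℕ), (π x : ℕ)) := by
  rw [cycleArcs, cons_orbitTail, h.orbitTail_append, List.zip_map', List.mem_map]
  constructor
  · rintro ⟨k, -, rfl⟩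
    exact ⟨(⇑π)^[k] (Fin.last m), by rw [Function.iterate_succ_apply']⟩
  · rintro ⟨x, rfl⟩
    obtain ⟨k, hk, rfl⟩ := h.exists_iterate_eq (Fin.last m) x
    exact ⟨k, List.mem_range.2 hk, by rw [Function.iterate_succ_apply']⟩

theorem IsCyclicPerm.arcsAvoid_iff (h : IsCyclicPerm π) :
    ArcsAvoid (cycleArcs m (orbitTail π)) ↔ Avoids π p132 := by
  rw [Avoids, contains_p132_iff]
  simp only [ArcsAvoid, h.mem_cycleArcs_iff]
  constructor
  · rintro H ⟨i, j, k, hij, hjk, h1, h2⟩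
    exact H _ ⟨i, rfl⟩ _ ⟨j, rfl⟩ _ ⟨k, rfl⟩ hij hjk h1 h2
  · rintro H _ ⟨i, rfl⟩ _ ⟨j, rfl⟩ _ ⟨k, rfl⟩ hij hjk h1 h2
    exact H ⟨i, j, k, hij, hjk, h1, h2⟩

theorem IsCyclicPerm.perm_orbitTail (h : IsCyclicPerm π) :
    (orbitTail π).Perm (List.range m) := by
  have hperm : (m :: orbitTail π).Perm (List.range (m + 1)) := by
    rw [cons_orbitTail, ← List.map_coe_finRange_eq_range, List.map_map]
    have := (Equiv.Perm.map_finRange_perm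
      (Equiv.ofBijective _ h.iterate_last_bijective)).map Fin.val
    rwa [List.map_map] at this
  rw [List.range_succ] at hperm
  exact (List.perm_cons m).1 (hperm.trans List.perm_append_comm)

theorem IsCyclicPerm.wordAvoids_iff (h : IsCyclicPerm π) :
    WordAvoids (orbitTail π) ↔ Avoids (theta π) p132 := by
  have hcons : WordAvoids (orbitTail π) ↔ WordAvoids (m :: orbitTail π) := by
    rw [WordAvoids, WordAvoids, List.triplewise_cons, and_iff_right]
    refine List.pairwise_of_forall_mem_list fun a _ b hb => ?_
    have := List.mem_range.1 (h.perm_orbitTail.mem_iff.1 hb)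
    omega
  rw [hcons, Avoids, contains_p132_iff, cons_orbitTail, WordAvoids, List.triplewise_iff_getElem]
  simp only [List.length_map, List.length_range, List.getElem_map, List.getElem_range,
    h.theta_apply, not_exists, not_and]
  constructor
  · intro H i j k hij hjk h1 h2
    exact H i j k hij hjk k.isLt h1 h2
  · intro H i j k hij hjk hk h1 h2
    exact H ⟨i, by omega⟩ ⟨j, by omega⟩ ⟨k, hk⟩ hij hjk h1 h2

theorem IsCyclicPerm.isGoodTail_orbitTail_iff (h : IsCyclicPerm π) :
    IsGoodTail m (orbitTail π) ↔ Avoids π p132 ∧ Avoids (theta π) p132 := by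
  rw [← h.arcsAvoid_iff, ← h.wordAvoids_iff]
  exact ⟨fun H => ⟨H.arcs, H.word⟩, fun H => ⟨h.perm_orbitTail, H.2, H.1⟩⟩

end Cyclic

theorem orbitTail_injOn (m : ℕ) :
    Set.InjOn orbitTail {π : Equiv.Perm (Fin (m + 1)) | IsCyclicPerm π} := by
  intro π hπ τ hτ heq
  ext x
  have h1 := (IsCyclicPerm.mem_cycleArcs_iff hπ _).2 ⟨x, rfl⟩
  rw [heq, IsCyclicPerm.mem_cycleArcs_iff hτ] at h1
  obtain ⟨y, hy⟩ := h1
  obtain ⟨h2, h3⟩ := Prod.mk.inj hy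
  rw [h3, Fin.ext h2]

theorem exists_isCyclicPerm_orbitTail_eq {m : ℕ} {t : List ℕ} (ht : t.Perm (List.range m)) :
    ∃ π : Equiv.Perm (Fin (m + 1)), IsCyclicPerm π ∧ orbitTail π = t := by
  have hperm : (m :: t).Perm (List.range (m + 1)) := by
    rw [List.range_succ]
    exact (ht.cons m).trans (List.perm_append_comm (l₁ := [m]))
  have hlt : ∀ x ∈ m :: t, x < m + 1 := fun x hx => List.mem_range.1 (hperm.mem_iff.1 hx)
  let l : List (Fin (m + 1)) := (m :: t).pmap Fin.mk hlt
  have hval : l.map Fin.val = m :: t := by simp [l, List.map_pmap]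
  have hlen : l.length = m + 1 := by
    have := hperm.length_eq
    simpa [l] using this
  have hnd : l.Nodup := by
    refine List.Nodup.of_map Fin.val ?_
    rw [hval]
    exact hperm.nodup_iff.2 List.nodup_range
  have hmem : ∀ x, x ∈ l := by
    intro x
    have : (x : ℕ) ∈ l.map Fin.val := by
      rw [hval, hperm.mem_iff]
      exact List.mem_range.2 x.isLt
    obtain ⟨y, hy, hyx⟩ := List.mem_map.1 this
    rwa [← Fin.ext hyx]
  have hpow : ∀ n i (hi : i < l.length), (⇑l.formPerm)^[n] l[i] =
      l[(i + n) % l.length]'(Nat.mod_lt _ (i.zero_le.trans_lt hi)) := by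
    intro n i hi
    rw [Equiv.Perm.iterate_eq_pow]
    exact List.formPerm_pow_apply_getElem l hnd n i hi
  have hcyc : IsCyclicPerm l.formPerm := by
    intro x y
    obtain ⟨i, hi, rfl⟩ := List.getElem_of_mem (hmem x)
    obtain ⟨j, hj, rfl⟩ := List.getElem_of_mem (hmem y)
    refine ⟨l.length - i + j, ?_⟩
    rw [hpow]
    congr 1
    rw [← Nat.add_assoc, Nat.add_sub_cancel' hi.le, Nat.add_mod_left, Nat.mod_eq_of_lt hj]
  refine ⟨l.formPerm, hcyc, ?_⟩
  have h0 : l[0]'(by omega) = Fin.last m := rfl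
  have : m :: orbitTail l.formPerm = m :: t := by
    rw [cons_orbitTail, ← hval]
    refine List.ext_getElem (by simp [hlen]) fun k h1 h2 => ?_
    have hk : k < l.length := by simpa using h2
    simp only [List.getElem_map, List.getElem_range, ← h0]
    rw [hpow]
    simp only [Nat.zero_add, Nat.mod_eq_of_lt hk]
  exact (List.cons.inj this).2

/-- for `n ≥ 1`, the number of cyclic permutations `π` with `π` and
`θ(π)` avoiding `132` is `F_n`. -/
theorem cyclic_t_n_132 (n : ℕ) (hn : 1 ≤ n) :
    Nat.card {π : Equiv.Perm (Fin n) //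
        IsCyclicPerm π ∧ Avoids π p132 ∧ Avoids (theta π) p132} = Nat.fib n := by
  obtain ⟨m, rfl⟩ := Nat.exists_eq_add_of_le' hn
  have himage : orbitTail '' {π : Equiv.Perm (Fin (m + 1)) |
      IsCyclicPerm π ∧ Avoids π p132 ∧ Avoids (theta π) p132} = goodTails m := by
    ext t
    simp only [Set.mem_image, Set.mem_ofPred_eq, Finset.mem_coe, mem_goodTails_iff]
    constructor
    · rintro ⟨π, ⟨hc, h⟩, rfl⟩
      exact hc.isGoodTail_orbitTail_iff.2 h
    · intro h
      obtain ⟨π, hc, rfl⟩ := exists_isCyclicPerm_orbitTail_eq h.perm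
      exact ⟨π, ⟨hc, hc.isGoodTail_orbitTail_iff.1 h⟩, rfl⟩
  have hcard := Set.InjOn.ncard_image ((orbitTail_injOn m).mono
    (fun π (hπ : IsCyclicPerm π ∧ Avoids π p132 ∧ Avoids (theta π) p132) => hπ.1))
  rw [← card_goodTails, ← Set.ncard_coe_finset, ← himage]
  exact hcard.symm
end
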